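/- arXiv:1606.06155 — 6 statements merged into one kernel-verified Lean document; each statement's English description precedes it below -/
import Mathlib

section
/- Let N be a positive integer, let k be a nonnegative integer and let s be a real number. Then there exists a constant γ ≥ 0 such that |x|^{2(k−s)} · |∇_N^k u_s(x)|² = γ for every x ∈ ℝ^N \ {0}, where u_s(x) = |x|^s. -/
open scoped BigOperators

/-- The partial derivative `∂ᵢ` of a real-valued function on `ℝ^N`. -/
noncomputable def pd {N : ℕ} (i : Fin N) (u : EuclideanSpace ℝ (Fin N) → ℝ) :
    EuclideanSpace ℝ (Fin N) → ℝ :=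
  fun x => fderiv ℝ u x (EuclideanSpace.single i 1)

/-- Iterated partial derivative `D_i = ∂_{i₁} ∂_{i₂} ⋯ ∂_{i_k}` for a list of indices. -/
noncomputable def pdIter {N : ℕ} (l : List (Fin N)) (u : EuclideanSpace ℝ (Fin N) → ℝ) :
    EuclideanSpace ℝ (Fin N) → ℝ :=
  l.foldr pd u

/-- `|∇_N^k u(x)|² = Σ_{i ∈ {1,…,N}^k} (D_i u(x))²`. -/
noncomputable def gradSq (N k : ℕ) (u : EuclideanSpace ℝ (Fin N) → ℝ)
    (x : EuclideanSpace ℝ (Fin N)) : ℝ :=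
  ∑ i : Fin k → Fin N, (pdIter (List.ofFn i) u x) ^ 2

/-- The falling factorial `(ν)_k = ν(ν−1)⋯(ν−k+1)`. -/
noncomputable def ffac (ν : ℝ) (k : ℕ) : ℝ := ∏ j ∈ Finset.range k, (ν - j)

/-- The generalized binomial coefficient `C(ν,k) = (ν)_k / k!`. -/
noncomputable def gchoose (ν : ℝ) (k : ℕ) : ℝ := ffac ν k / (Nat.factorial k)

theorem multilinear_sum_sq_basis {N : ℕ} (b c : OrthonormalBasis (Fin N) ℝ (EuclideanSpace ℝ (Fin N)))
    (k : ℕ) (T : MultilinearMap ℝ (fun _ : Fin k => EuclideanSpace ℝ (Fin N)) ℝ) :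
    ∑ i : Fin k → Fin N, (T (fun j => b (i j))) ^ 2
      = ∑ i : Fin k → Fin N, (T (fun j => c (i j))) ^ 2 := by
  induction k with
  | zero =>
    refine Finset.sum_congr rfl fun i _ => ?_
    congr 2
    funext j
    exact j.elim0
  | succ k ih =>
    have split : ∀ d : OrthonormalBasis (Fin N) ℝ (EuclideanSpace ℝ (Fin N)),
        ∑ i : Fin (k + 1) → Fin N, (T (fun j => d (i j))) ^ 2
          = ∑ a : Fin N, ∑ i : Fin k → Fin N, (T.curryLeft (d a) (fun j => d (i j))) ^ 2 := by
      intro d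
      rw [← Fintype.sum_prod_type',
        ← (Fin.consEquiv (fun _ : Fin (k + 1) => Fin N)).sum_comp]
      refine Finset.sum_congr rfl fun p _ => ?_
      rw [MultilinearMap.curryLeft_apply]
      congr 2
      funext j
      refine Fin.cases ?_ (fun j => ?_) j <;> simp [Fin.consEquiv]
    rw [split b, split c]
    have h1 : ∀ a, ∑ i : Fin k → Fin N, (T.curryLeft (b a) (fun j => b (i j))) ^ 2
        = ∑ i : Fin k → Fin N, (T.curryLeft (b a) (fun j => c (i j))) ^ 2 :=
      fun a => ih _
    simp_rw [h1]
    rw [Finset.sum_comm, Finset.sum_comm (s := (Finset.univ : Finset (Fin N)))]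
    refine Finset.sum_congr rfl fun i _ => ?_
    let φ : EuclideanSpace ℝ (Fin N) →ₗ[ℝ] ℝ :=
      { toFun := fun v => T.curryLeft v (fun j => c (i j))
        map_add' := fun v w => by rw [map_add]; rfl
        map_smul' := fun r v => by rw [map_smul]; rfl }
    let w := (InnerProductSpace.toDual ℝ (EuclideanSpace ℝ (Fin N))).symm φ.toContinuousLinearMap
    have hw : ∀ v, T.curryLeft v (fun j => c (i j)) = inner ℝ w v := by
      intro v
      rw [InnerProductSpace.toDual_symm_apply]
      rfl
    simp_rw [hw]
    rw [b.sum_sq_inner_left, c.sum_sq_inner_left]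

theorem pdIter_eq_iteratedFDeriv {N : ℕ} (u : EuclideanSpace ℝ (Fin N) → ℝ)
    (hu : ∀ x, x ≠ 0 → ∀ n : ℕ, ContDiffAt ℝ n u x) (k : ℕ) (i : Fin k → Fin N) :
    ∀ x, x ≠ 0 → pdIter (List.ofFn i) u x
      = iteratedFDeriv ℝ k u x (fun j => EuclideanSpace.basisFun (Fin N) ℝ (i j)) := by
  induction k with
  | zero => intro x _; simp [pdIter]
  | succ k ih =>
    intro x hx
    have hd : DifferentiableAt ℝ (iteratedFDeriv ℝ k u) x :=
      (hu x hx (k + 1)).differentiableAt_iteratedFDeriv (by exact_mod_cast Nat.lt_succ_self k)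
    have he : pdIter (List.ofFn fun j : Fin k => i j.succ) u =ᶠ[nhds x]
        fun y => iteratedFDeriv ℝ k u y
          (fun j => EuclideanSpace.basisFun (Fin N) ℝ (i j.succ)) := by
      filter_upwards [isOpen_ne.mem_nhds hx] with y hy
      exact ih _ y hy
    rw [List.ofFn_succ, iteratedFDeriv_succ_apply_left]
    change fderiv ℝ (pdIter (List.ofFn fun j : Fin k => i j.succ) u) x _ = _
    rw [he.fderiv_eq, fderiv_continuousMultilinear_apply_const_apply hd]
    simp [Fin.tail_def]

theorem stmt_0 (N : ℕ) (hN : 0 < N) (k : ℕ) (s : ℝ) :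
    ∃ γ : ℝ, 0 ≤ γ ∧ ∀ x : EuclideanSpace ℝ (Fin N), x ≠ 0 →
      ‖x‖ ^ (2 * ((k : ℝ) - s)) * gradSq N k (fun y => ‖y‖ ^ s) x = γ := by
  set f : EuclideanSpace ℝ (Fin N) → ℝ := fun y => ‖y‖ ^ s with hf
  have hu : ∀ x, x ≠ 0 → ∀ n : ℕ, ContDiffAt ℝ n f x := fun x hx n =>
    (contDiffAt_norm ℝ hx).rpow_const_of_ne (norm_ne_zero_iff.2 hx)
  let e : EuclideanSpace ℝ (Fin N) := EuclideanSpace.single ⟨0, hN⟩ 1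
  have hen : ‖e‖ = 1 := by simp [e]
  have he0 : e ≠ 0 := by
    intro h
    rw [h, norm_zero] at hen
    exact zero_ne_one hen
  refine ⟨gradSq N k f e, Finset.sum_nonneg fun _ _ => sq_nonneg _, fun x hx => ?_⟩
  have ht : 0 < ‖x‖ := norm_pos_iff.2 hx
  set t := ‖x‖ with htdef
  obtain ⟨R, hR⟩ : ∃ R : EuclideanSpace ℝ (Fin N) ≃ₗᵢ[ℝ] EuclideanSpace ℝ (Fin N),
      R (t • e) = x :=
    ⟨_, Submodule.reflection_sub (by rw [norm_smul, hen, Real.norm_of_nonneg ht.le, mul_one])⟩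
  let g : EuclideanSpace ℝ (Fin N) ≃L[ℝ] EuclideanSpace ℝ (Fin N) :=
    (ContinuousLinearEquiv.smulLeft (Units.mk0 t ht.ne')).trans R.toContinuousLinearEquiv
  have hg : ∀ v, g v = t • R v := fun v => by
    change R (t • v) = _
    rw [map_smul]
  have hge : g e = x := hR
  have hfg : f ∘ g = t ^ s • f := by
    funext v
    simp only [Function.comp, hf, hg, Pi.smul_apply, smul_eq_mul, norm_smul, R.norm_map,
      Real.norm_of_nonneg ht.le]
    exact Real.mul_rpow ht.le (norm_nonneg v)
  have key : ∀ m : Fin k → EuclideanSpace ℝ (Fin N),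
      t ^ s * iteratedFDeriv ℝ k f e m = t ^ k * iteratedFDeriv ℝ k f x (fun j => R (m j)) := by
    intro m
    have h := g.iteratedFDerivWithin_comp_right f uniqueDiffOn_univ (Set.mem_univ (g e)) k
    rw [Set.preimage_univ, iteratedFDerivWithin_univ, iteratedFDerivWithin_univ, hfg, hge,
      iteratedFDeriv_const_smul_apply (hu e he0 k)] at h
    have h2 := congrArg (fun T => T m) h
    simp only [ContinuousMultilinearMap.smul_apply, smul_eq_mul,
      ContinuousMultilinearMap.compContinuousLinearMap_apply] at h2
    rw [h2]
    have h3 := (iteratedFDeriv ℝ k f x).map_smul_univ (fun _ => t) (fun j => R (m j))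
    simp only [Finset.prod_const, Finset.card_univ, Fintype.card_fin, smul_eq_mul] at h3
    rw [← h3]
    congr 1
    funext j
    exact hg _
  have hsum : ∀ y, y ≠ 0 → gradSq N k f y = ∑ i : Fin k → Fin N,
      (iteratedFDeriv ℝ k f y (fun j => EuclideanSpace.basisFun (Fin N) ℝ (i j))) ^ 2 :=
    fun y hy => Finset.sum_congr rfl fun i _ => by rw [pdIter_eq_iteratedFDeriv f hu k i y hy]
  have hrot := multilinear_sum_sq_basis (EuclideanSpace.basisFun (Fin N) ℝ)
    ((EuclideanSpace.basisFun (Fin N) ℝ).map R) k (iteratedFDeriv ℝ k f x).toMultilinearMap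
  have hmain : (t ^ s) ^ 2 * gradSq N k f e = (t ^ k) ^ 2 * gradSq N k f x := by
    rw [hsum e he0, hsum x hx]
    refine Eq.trans ?_ (congrArg (fun z => (t ^ k) ^ 2 * z) hrot.symm)
    rw [Finset.mul_sum, Finset.mul_sum]
    refine Finset.sum_congr rfl fun i _ => ?_
    rw [← mul_pow, ← mul_pow, key]
    simp only [OrthonormalBasis.map_apply]
    rfl
  have hpow : t ^ (2 * ((k : ℝ) - s)) = (t ^ k) ^ 2 / (t ^ s) ^ 2 := by
    rw [mul_comm, Real.rpow_mul ht.le, Real.rpow_sub ht, Real.rpow_natCast, ← div_pow]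
    exact Real.rpow_natCast _ 2
  have hts : (t ^ s) ^ 2 ≠ 0 := pow_ne_zero _ (Real.rpow_pos_of_pos ht s).ne'
  rw [hpow, div_mul_eq_mul_div, ← hmain, mul_div_cancel_left₀ _ hts]
end

section
/- Let N and k be positive integers. Then there exists a constant ℓ > 0 such that |x|^{2k} · |∇_N^k v(x)|² = ℓ for every x ∈ ℝ^N \ {0}, where v(x) = log|x|. -/
open scoped BigOperators

/-- The logarithm of the norm is smooth away from the origin. -/
lemma logNorm_contDiffAt {N : ℕ} {x : EuclideanSpace ℝ (Fin N)} (hx : x ≠ 0) (n : ℕ∞) :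
    ContDiffAt ℝ n (fun y : EuclideanSpace ℝ (Fin N) => Real.log ‖y‖) x :=
  (contDiffAt_norm ℝ hx).log (norm_ne_zero_iff.mpr hx)

/-- Iterated partial derivatives are values of the iterated Fréchet derivative. -/
lemma pdIter_eq {N : ℕ} (k : ℕ) : ∀ (i : Fin k → Fin N) (x : EuclideanSpace ℝ (Fin N)), x ≠ 0 →
    pdIter (List.ofFn i) (fun y => Real.log ‖y‖) x =
      iteratedFDeriv ℝ k (fun y : EuclideanSpace ℝ (Fin N) => Real.log ‖y‖) x
        (fun j => EuclideanSpace.single (i j) 1) := by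
  induction k with
  | zero => intro i x hx; simp [pdIter]
  | succ k ih =>
    intro i x hx
    rw [List.ofFn_succ, iteratedFDeriv_succ_apply_left]
    change fderiv ℝ (pdIter (List.ofFn fun j => i j.succ) _) x _ = _
    have hd : DifferentiableAt ℝ (iteratedFDeriv ℝ k
        (fun y : EuclideanSpace ℝ (Fin N) => Real.log ‖y‖)) x :=
      (logNorm_contDiffAt hx ⊤).differentiableAt_iteratedFDeriv (by exact_mod_cast WithTop.coe_lt_top k)
    have hev : pdIter (List.ofFn fun j => i j.succ)
        (fun y : EuclideanSpace ℝ (Fin N) => Real.log ‖y‖) =ᶠ[nhds x] fun y =>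
        iteratedFDeriv ℝ k (fun y : EuclideanSpace ℝ (Fin N) => Real.log ‖y‖) y
        (fun j => EuclideanSpace.single (i j.succ) 1) := by
      filter_upwards [isOpen_ne.mem_nhds hx] with y hy
      exact ih _ y hy
    rw [hev.fderiv_eq]
    have h1 := (ContinuousMultilinearMap.apply ℝ (fun _ : Fin k => EuclideanSpace ℝ (Fin N)) ℝ
      (fun j => EuclideanSpace.single (i j.succ) 1)).hasFDerivAt.comp x hd.hasFDerivAt
    have h2 := h1.fderiv
    simp only [Function.comp_def, ContinuousMultilinearMap.apply_apply] at h2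
    rw [h2]
    rfl

/-- Sum of squares of a multilinear form over an orthonormal basis is basis independent. -/
lemma sum_sq_basis {E : Type*} [NormedAddCommGroup E] [InnerProductSpace ℝ E] [CompleteSpace E]
    {N : ℕ} (b b' : OrthonormalBasis (Fin N) ℝ E) (k : ℕ) :
    ∀ T : ContinuousMultilinearMap ℝ (fun _ : Fin k => E) ℝ,
    ∑ i : Fin k → Fin N, (T fun j => b (i j)) ^ 2 =
      ∑ i : Fin k → Fin N, (T fun j => b' (i j)) ^ 2 := by
  induction k with
  | zero =>
    intro T
    refine Finset.sum_congr rfl fun i _ => ?_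
    congr 2
    exact Subsingleton.elim _ _
  | succ k ih =>
    intro T
    have key : ∀ c : OrthonormalBasis (Fin N) ℝ E,
        ∑ i : Fin (k + 1) → Fin N, (T fun j => c (i j)) ^ 2 =
        ∑ a : Fin N, ∑ i : Fin k → Fin N, (T.curryLeft (c a) fun j => c (i j)) ^ 2 := by
      intro c
      rw [← Fintype.sum_prod_type', ← (Fin.consEquiv fun _ : Fin (k + 1) => Fin N).sum_comp]
      refine Finset.sum_congr rfl fun p _ => ?_
      rw [ContinuousMultilinearMap.curryLeft_apply]
      congr 2
      funext j
      refine Fin.cases ?_ (fun j => ?_) j <;> simp [Fin.consEquiv]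
    have pars : ∀ (L : E →L[ℝ] ℝ), ∑ a, (L (b a)) ^ 2 = ∑ a, (L (b' a)) ^ 2 := by
      intro L
      obtain ⟨v, rfl⟩ := (InnerProductSpace.toDual ℝ E).surjective L
      simp only [InnerProductSpace.toDual_apply_apply]
      rw [b.sum_sq_inner_left, b'.sum_sq_inner_left]
    rw [key, key]
    simp_rw [ih]
    rw [Finset.sum_comm, Finset.sum_comm (s := Finset.univ (α := Fin N))]
    refine Finset.sum_congr rfl fun i _ => ?_
    exact pars ((ContinuousMultilinearMap.apply ℝ (fun _ : Fin k => E) ℝ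
      (fun j => b' (i j))).comp T.curryLeft)

/-- Invariance under similarities. -/
lemma gradSq_invariant {N k : ℕ} (hk : 0 < k) {x y : EuclideanSpace ℝ (Fin N)} (hx : x ≠ 0)
    (hy : y ≠ 0) : ‖x‖ ^ (2 * k) * gradSq N k (fun y => Real.log ‖y‖) x =
      ‖y‖ ^ (2 * k) * gradSq N k (fun y => Real.log ‖y‖) y := by
  have hx' := norm_pos_iff.mpr hx
  have hy' := norm_pos_iff.mpr hy
  obtain ⟨c, hc, hcn⟩ : ∃ c : ℝ, 0 < c ∧ ‖y‖ = c * ‖x‖ :=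
    ⟨‖y‖ / ‖x‖, by positivity, by field_simp⟩
  obtain ⟨R, hR⟩ : ∃ R : EuclideanSpace ℝ (Fin N) ≃ₗᵢ[ℝ] EuclideanSpace ℝ (Fin N),
      R (c • x) = y := by
    refine ⟨_, Submodule.reflection_sub ?_⟩
    rw [norm_smul, Real.norm_of_nonneg hc.le, hcn]
  let A : EuclideanSpace ℝ (Fin N) ≃L[ℝ] EuclideanSpace ℝ (Fin N) :=
    (ContinuousLinearEquiv.smulLeft (Units.mk0 c hc.ne')).trans R.toContinuousLinearEquiv
  have hA : ∀ z, A z = c • R z := fun z => R.map_smul c z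
  have hAx : A x = y := hR
  let u : EuclideanSpace ℝ (Fin N) → ℝ := fun y => Real.log ‖y‖
  have hcomp : iteratedFDeriv ℝ k (u ∘ A) x =
      (iteratedFDeriv ℝ k u y).compContinuousLinearMap fun _ => A := by
    have := A.iteratedFDerivWithin_comp_right u uniqueDiffOn_univ (x := x) (Set.mem_univ _) k
    simpa only [Set.preimage_univ, iteratedFDerivWithin_univ, hAx] using this
  have hsh : iteratedFDeriv ℝ k (u ∘ A) x = iteratedFDeriv ℝ k u x := by
    have hev : u ∘ A =ᶠ[nhds x] (fun _ => Real.log c) + u := by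
      filter_upwards [isOpen_ne.mem_nhds hx] with z hz
      simp only [u, Function.comp, Pi.add_apply, hA, norm_smul, Real.norm_of_nonneg hc.le,
        LinearIsometryEquiv.norm_map]
      exact Real.log_mul hc.ne' (norm_ne_zero_iff.mpr hz)
    rw [(hev.iteratedFDeriv ℝ k).eq_of_nhds, iteratedFDeriv_add_apply contDiffAt_const
      (logNorm_contDiffAt hx k), iteratedFDeriv_const_of_ne hk.ne']
    simp [u]
  have hT : ∀ m : Fin k → EuclideanSpace ℝ (Fin N), iteratedFDeriv ℝ k u x m =
      c ^ k * iteratedFDeriv ℝ k u y (fun j => R (m j)) := by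
    intro m
    rw [← hsh, hcomp, ContinuousMultilinearMap.compContinuousLinearMap_apply]
    simp only [ContinuousLinearEquiv.coe_coe, hA]
    rw [ContinuousMultilinearMap.map_smul_univ]
    simp
  have hg : gradSq N k u x = c ^ (2 * k) * gradSq N k u y := by
    unfold gradSq
    simp only [u, pdIter_eq k _ x hx, pdIter_eq k _ y hy]
    have hb := sum_sq_basis (EuclideanSpace.basisFun (Fin N) ℝ)
      ((EuclideanSpace.basisFun (Fin N) ℝ).map R) k (iteratedFDeriv ℝ k u y)
    simp only [OrthonormalBasis.map_apply, EuclideanSpace.basisFun_apply] at hb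
    rw [hb, Finset.mul_sum]
    refine Finset.sum_congr rfl fun i _ => ?_
    have := hT fun j => EuclideanSpace.single (i j) 1
    simp only [u] at this ⊢
    rw [this]
    ring
  change _ * gradSq N k u x = _ * gradSq N k u y
  rw [hg, hcn, mul_pow]
  ring

/-- Derivatives along a coordinate ray. -/
lemma pdIter_ray {N : ℕ} (a : Fin N) (k : ℕ) : ∀ t : ℝ, 0 < t →
    pdIter (List.ofFn fun _ : Fin (k + 1) => a) (fun y => Real.log ‖y‖)
      (t • EuclideanSpace.single a 1) = (-1) ^ k * (k.factorial : ℝ) * t ^ (-(k + 1 : ℤ)) := by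
  have hne : ∀ t : ℝ, 0 < t → t • EuclideanSpace.single a (1 : ℝ) ≠ 0 := by
    intro t ht
    simp [ht.ne']
  have hdiff : ∀ (k : ℕ) (t : ℝ), 0 < t → DifferentiableAt ℝ
      (pdIter (List.ofFn fun _ : Fin k => a) (fun y => Real.log ‖y‖))
      (t • EuclideanSpace.single a (1 : ℝ)) := by
    intro k t ht
    have hd : DifferentiableAt ℝ (iteratedFDeriv ℝ k
        (fun y : EuclideanSpace ℝ (Fin N) => Real.log ‖y‖)) (t • EuclideanSpace.single a (1 : ℝ)) :=
      (logNorm_contDiffAt (hne t ht) ⊤).differentiableAt_iteratedFDeriv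
        (by exact_mod_cast WithTop.coe_lt_top k)
    have h1 := (ContinuousMultilinearMap.apply ℝ (fun _ : Fin k => EuclideanSpace ℝ (Fin N)) ℝ
      (fun _ => EuclideanSpace.single a 1)).differentiableAt.comp _ hd
    refine h1.congr_of_eventuallyEq ?_
    filter_upwards [isOpen_ne.mem_nhds (hne t ht)] with y hy
    exact pdIter_eq k _ y hy
  have step : ∀ (k : ℕ) (t : ℝ), 0 < t →
      HasDerivAt (fun s : ℝ => pdIter (List.ofFn fun _ : Fin k => a) (fun y => Real.log ‖y‖)
      (s • EuclideanSpace.single a (1 : ℝ))) (pdIter (List.ofFn fun _ : Fin (k + 1) => a)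
      (fun y => Real.log ‖y‖) (t • EuclideanSpace.single a (1 : ℝ))) t := by
    intro k t ht
    have h1 : HasDerivAt (fun s : ℝ => s • EuclideanSpace.single a (1 : ℝ))
        (EuclideanSpace.single a (1 : ℝ)) t := by
      simpa using (hasDerivAt_id t).smul_const (EuclideanSpace.single a (1 : ℝ))
    have h2 := (hdiff k t ht).hasFDerivAt.comp_hasDerivAt t h1
    rw [List.ofFn_succ]
    exact h2
  induction k with
  | zero =>
    intro t ht
    refine (step 0 t ht).unique ?_
    have : HasDerivAt Real.log (t⁻¹) t := Real.hasDerivAt_log ht.ne'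
    have h3 := this.congr_of_eventuallyEq (f₁ := fun s : ℝ =>
      pdIter (List.ofFn fun _ : Fin 0 => a) (fun y => Real.log ‖y‖)
      (s • EuclideanSpace.single a (1 : ℝ))) (Filter.Eventually.of_forall fun s => by
        simp [pdIter, norm_smul])
    simpa using h3
  | succ k ih =>
    intro t ht
    refine (step (k + 1) t ht).unique ?_
    have h1 := (hasDerivAt_zpow (-(k + 1 : ℤ)) t (Or.inl ht.ne')).const_mul
      ((-1) ^ k * (k.factorial : ℝ))
    have h2 := h1.congr_of_eventuallyEq (f₁ := fun s : ℝ =>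
      pdIter (List.ofFn fun _ : Fin (k + 1) => a) (fun y => Real.log ‖y‖)
      (s • EuclideanSpace.single a (1 : ℝ))) (by
        filter_upwards [lt_mem_nhds ht] with s hs
        exact ih s hs)
    convert h2 using 1
    have e : (-(((k + 1 : ℕ) : ℤ) + 1)) = -(k + 1 : ℤ) - 1 := by push_cast; ring
    rw [e, Nat.factorial_succ]
    push_cast
    ring

theorem stmt_1 (N k : ℕ) (hN : 0 < N) (hk : 0 < k) :
    ∃ ℓ : ℝ, 0 < ℓ ∧ ∀ x : EuclideanSpace ℝ (Fin N), x ≠ 0 →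
      ‖x‖ ^ (2 * k) * gradSq N k (fun y => Real.log ‖y‖) x = ℓ := by
  have hx0 : EuclideanSpace.single (⟨0, hN⟩ : Fin N) (1 : ℝ) ≠ 0 := by simp
  refine ⟨_, ?_, fun x hx => gradSq_invariant hk hx hx0⟩
  refine mul_pos (by positivity) ?_
  obtain ⟨k, rfl⟩ := Nat.exists_eq_succ_of_ne_zero hk.ne'
  unfold gradSq
  refine Finset.sum_pos' (fun _ _ => sq_nonneg _) ⟨fun _ => ⟨0, hN⟩, Finset.mem_univ _, ?_⟩
  have h := pdIter_ray (⟨0, hN⟩ : Fin N) k 1 one_pos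
  rw [one_smul] at h
  rw [Nat.succ_eq_add_one, h]
  have : (k.factorial : ℝ) ≠ 0 := by exact_mod_cast k.factorial_ne_zero
  exact sq_pos_of_ne_zero (by simp [this])
end

section
/- Let N be a positive integer, let k be a nonnegative integer and let s be a real number. Then for every x ∈ ℝ^N \ {0}, |x|^{2(k−s)} · |∇_N^k u_s(x)|² = k! · Σ_{l=0}^{⌊k/2⌋} (k−2l)! · l! · ((N−3)/2 + l)_l · ( Σ_{n=⌈k/2⌉}^{k−l} 2^{2n−k+l} · C(s/2, n) · C(n, k−n) · C(k−n, l) )², where u_s(x) = |x|^s. -/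
open scoped BigOperators

open MvPolynomial

section Fischer
variable {N : ℕ}

noncomputable def Lf : List (Fin N) → (MvPolynomial (Fin N) ℝ →ₗ[ℝ] ℝ)
  | [] => (MvPolynomial.aeval (0 : Fin N → ℝ)).toLinearMap
  | j :: i => (Lf i).comp (pderiv j).toLinearMap

theorem Lf_nil (p : MvPolynomial (Fin N) ℝ) : Lf [] p = MvPolynomial.aeval (0 : Fin N → ℝ) p := rfl
theorem Lf_cons (j : Fin N) (i : List (Fin N)) (p : MvPolynomial (Fin N) ℝ) :
    Lf (j :: i) p = Lf i (pderiv j p) := rfl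

noncomputable def BB (k : ℕ) (p q : MvPolynomial (Fin N) ℝ) : ℝ :=
  ∑ i : Fin k → Fin N, Lf (List.ofFn i) p * Lf (List.ofFn i) q

theorem BB_zero (p q : MvPolynomial (Fin N) ℝ) :
    BB 0 p q = MvPolynomial.aeval (0 : Fin N → ℝ) p * MvPolynomial.aeval (0 : Fin N → ℝ) q := by
  simp [BB, Lf_nil]

theorem BB_succ (k : ℕ) (p q : MvPolynomial (Fin N) ℝ) :
    BB (k+1) p q = ∑ j, BB k (pderiv j p) (pderiv j q) := by
  unfold BB
  rw [← (Fin.consEquiv (fun _ : Fin (k+1) => Fin N)).sum_comp, Fintype.sum_prod_type]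
  refine Finset.sum_congr rfl fun j _ => Finset.sum_congr rfl fun i _ => ?_
  simp [Fin.consEquiv, List.ofFn_succ, Lf_cons]

theorem BB_symm (k : ℕ) (p q : MvPolynomial (Fin N) ℝ) : BB k p q = BB k q p := by
  unfold BB
  exact Finset.sum_congr rfl fun i _ => mul_comm _ _

theorem BB_add_left (k : ℕ) (p p' q : MvPolynomial (Fin N) ℝ) :
    BB k (p + p') q = BB k p q + BB k p' q := by
  simp [BB, add_mul, Finset.sum_add_distrib]

theorem BB_smul_left (k : ℕ) (c : ℝ) (p q : MvPolynomial (Fin N) ℝ) :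
    BB k (c • p) q = c * BB k p q := by
  simp [BB, Finset.mul_sum, mul_assoc]

theorem BB_sum_left {ι : Type*} (t : Finset ι) (k : ℕ) (p : ι → MvPolynomial (Fin N) ℝ)
    (q : MvPolynomial (Fin N) ℝ) :
    BB k (∑ m ∈ t, p m) q = ∑ m ∈ t, BB k (p m) q := by
  unfold BB
  rw [Finset.sum_comm]
  simp [Finset.sum_mul]

theorem BB_sub_left (k : ℕ) (p p' q : MvPolynomial (Fin N) ℝ) :
    BB k (p - p') q = BB k p q - BB k p' q := by
  simp [BB, sub_mul, Finset.sum_sub_distrib]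

theorem BB_add_right (k : ℕ) (p q q' : MvPolynomial (Fin N) ℝ) :
    BB k p (q + q') = BB k p q + BB k p q' := by
  rw [BB_symm, BB_add_left, BB_symm k q, BB_symm k q']

theorem BB_sub_right (k : ℕ) (p q q' : MvPolynomial (Fin N) ℝ) :
    BB k p (q - q') = BB k p q - BB k p q' := by
  rw [BB_symm, BB_sub_left, BB_symm k q, BB_symm k q']

theorem BB_smul_right (k : ℕ) (c : ℝ) (p q : MvPolynomial (Fin N) ℝ) :
    BB k p (c • q) = c * BB k p q := by
  rw [BB_symm, BB_smul_left, BB_symm]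

theorem BB_sum_right {ι : Type*} (t : Finset ι) (k : ℕ) (p : ι → MvPolynomial (Fin N) ℝ)
    (q : MvPolynomial (Fin N) ℝ) :
    BB k q (∑ m ∈ t, p m) = ∑ m ∈ t, BB k q (p m) := by
  rw [BB_symm, BB_sum_left]
  exact Finset.sum_congr rfl fun i _ => BB_symm _ _ _

theorem pd_comm (i j : Fin N) (p : MvPolynomial (Fin N) ℝ) :
    pderiv i (pderiv j p) = pderiv j (pderiv i p) := by
  have h : ⁅(pderiv i : Derivation ℝ (MvPolynomial (Fin N) ℝ) (MvPolynomial (Fin N) ℝ)),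
      (pderiv j : Derivation ℝ (MvPolynomial (Fin N) ℝ) (MvPolynomial (Fin N) ℝ))⁆ = 0 := by
    apply MvPolynomial.derivation_ext
    intro m
    simp [Derivation.commutator_apply, pderiv_X, Pi.single_apply, apply_ite]
  have := congrArg (fun d => d p) h
  simpa [Derivation.commutator_apply, sub_eq_zero] using this

theorem BB_adjX (k : ℕ) (j : Fin N) : ∀ (p q : MvPolynomial (Fin N) ℝ),
    BB (k+1) (X j * p) q = (k+1) * BB k p (pderiv j q) := by
  have key : ∀ (k : ℕ) (p q : MvPolynomial (Fin N) ℝ), BB (k+1) (X j * p) q =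
      BB k p (pderiv j q) + ∑ i, BB k (X j * pderiv i p) (pderiv i q) := by
    intro k p q
    rw [BB_succ]
    have : ∀ i, BB k (pderiv i (X j * p)) (pderiv i q) =
        (if i = j then BB k p (pderiv j q) else 0) + BB k (X j * pderiv i p) (pderiv i q) := by
      intro i
      rw [pderiv_mul, BB_add_left]
      congr 1
      by_cases h : i = j
      · subst h; simp
      · rw [pderiv_X_of_ne (Ne.symm h)]; simp [h, BB]
    simp only [this, Finset.sum_add_distrib]
    simp
  induction k with
  | zero => intro p q; rw [key]; simp [BB_zero]
  | succ k ih =>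
    intro p q
    rw [key]
    simp only [ih]
    rw [← Finset.mul_sum]
    simp only [pd_comm j]
    rw [← BB_succ]
    push_cast; ring

noncomputable def aa (e : Fin N → ℝ) : MvPolynomial (Fin N) ℝ := ∑ j, e j • X j
noncomputable def De (e : Fin N → ℝ) : Derivation ℝ (MvPolynomial (Fin N) ℝ) (MvPolynomial (Fin N) ℝ) :=
  ∑ j, e j • pderiv j
noncomputable def RR (e : Fin N → ℝ) : MvPolynomial (Fin N) ℝ := ∑ j, X j * X j - aa e * aa e

noncomputable def Lap (e : Fin N → ℝ) (q : MvPolynomial (Fin N) ℝ) : MvPolynomial (Fin N) ℝ :=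
  ∑ j, pderiv j (pderiv j q) - De e (De e q)

theorem De_apply (e : Fin N → ℝ) (q : MvPolynomial (Fin N) ℝ) :
    De e q = ∑ j, e j • pderiv j q := by
  have : ∀ t : Finset (Fin N), (∑ j ∈ t, e j • pderiv j :
    Derivation ℝ (MvPolynomial (Fin N) ℝ) (MvPolynomial (Fin N) ℝ)) q = ∑ j ∈ t, e j • pderiv j q := by
    intro t
    induction t using Finset.cons_induction with
    | empty => simp
    | cons a t h ih => rw [Finset.sum_cons, Finset.sum_cons, Derivation.add_apply, ih]; rfl
  exact this _

theorem BB_adja (e : Fin N → ℝ) (k : ℕ) (p q : MvPolynomial (Fin N) ℝ) :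
    BB (k+1) (aa e * p) q = (k+1) * BB k p (De e q) := by
  rw [aa, Finset.sum_mul, BB_sum_left, De_apply, BB_sum_right, Finset.mul_sum]
  refine Finset.sum_congr rfl fun j _ => ?_
  rw [smul_mul_assoc, BB_smul_left, BB_adjX, BB_smul_right]; ring

theorem BB_adjR (e : Fin N → ℝ) (k : ℕ) (p q : MvPolynomial (Fin N) ℝ) :
    BB (k+2) (RR e * p) q = (k+2) * (k+1) * BB k p (Lap e q) := by
  rw [RR, sub_mul, BB_sub_left, mul_assoc (aa e), BB_adja, BB_adja, Finset.sum_mul, BB_sum_left,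
    Lap, BB_sub_right, BB_sum_right, mul_sub, Finset.mul_sum]
  congr 1
  · refine Finset.sum_congr rfl fun j _ => ?_
    rw [mul_assoc, BB_adjX, BB_adjX]; push_cast; ring
  · push_cast; ring

theorem pderiv_aa (e : Fin N → ℝ) (j : Fin N) : pderiv j (aa e) = C (e j) := by
  simp [aa, pderiv_X, Pi.single_apply, MvPolynomial.smul_eq_C_mul]

theorem De_aa (e : Fin N → ℝ) (he : ∑ j, e j ^ 2 = 1) : De e (aa e) = 1 := by
  rw [De_apply]
  simp only [pderiv_aa, MvPolynomial.smul_eq_C_mul]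
  have h : ∑ j, (C (e j) * C (e j) : MvPolynomial (Fin N) ℝ) = C (∑ j, e j ^ 2) := by
    rw [map_sum]; exact Finset.sum_congr rfl fun j _ => by rw [pow_two, C_mul]
  rw [h, he]; simp

theorem pderiv_RR (e : Fin N → ℝ) (j : Fin N) :
    pderiv j (RR e) = 2 * X j - 2 * (C (e j) * aa e) := by
  have : ∀ i : Fin N, pderiv j (X i * X i : MvPolynomial (Fin N) ℝ) = if i = j then 2 * X j else 0 := by
    intro i
    by_cases h : i = j
    · subst h; simp [pderiv_mul]; ring
    · simp [pderiv_mul, pderiv_X_of_ne h, h]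
  simp only [RR, map_sub, map_sum, this, pderiv_mul, pderiv_aa]
  simp; ring

theorem De_RR (e : Fin N → ℝ) (he : ∑ j, e j ^ 2 = 1) : De e (RR e) = 0 := by
  rw [De_apply]
  simp only [pderiv_RR, smul_sub, Finset.sum_sub_distrib]
  have h1 : ∑ j, e j • (2 * X j : MvPolynomial (Fin N) ℝ) = 2 * aa e := by
    rw [aa, Finset.mul_sum]; exact Finset.sum_congr rfl fun j _ => by rw [mul_smul_comm]
  have h2 : ∑ j, e j • (2 * (C (e j) * aa e) : MvPolynomial (Fin N) ℝ) = C (∑ j, e j ^ 2) * (2 * aa e) := by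
    rw [map_sum, Finset.sum_mul]
    exact Finset.sum_congr rfl fun j _ => by rw [MvPolynomial.smul_eq_C_mul, pow_two, C_mul]; ring
  rw [h1, h2, he]; simp

theorem Lap_mul (e : Fin N → ℝ) (p q : MvPolynomial (Fin N) ℝ) :
    Lap e (p * q) = p * Lap e q + q * Lap e p + 2 * (∑ j, pderiv j p * pderiv j q - De e p * De e q) := by
  simp only [Lap, Derivation.leibniz, map_add, smul_eq_mul, Finset.sum_add_distrib, mul_sub,
    Finset.mul_sum]
  have h : ∀ f g : Fin N → MvPolynomial (Fin N) ℝ, ∑ j, f j * g j = ∑ j, g j * f j :=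
    fun f g => Finset.sum_congr rfl fun j _ => mul_comm _ _
  simp only [two_mul, Finset.sum_add_distrib]
  rw [h (fun j => pderiv j q)]
  ring

theorem Lap_aa_mul (e : Fin N → ℝ) (he : ∑ j, e j ^ 2 = 1) (q : MvPolynomial (Fin N) ℝ) :
    Lap e (aa e * q) = aa e * Lap e q := by
  rw [Lap_mul, De_aa e he]
  have : Lap e (aa e) = 0 := by simp [Lap, pderiv_aa, De_aa e he]
  rw [this]
  simp only [pderiv_aa, De_apply e q, MvPolynomial.smul_eq_C_mul]
  simp

noncomputable def WW (e : Fin N → ℝ) (q : MvPolynomial (Fin N) ℝ) : MvPolynomial (Fin N) ℝ :=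
  ∑ j, X j * pderiv j q - aa e * De e q

theorem WW_mul (e : Fin N → ℝ) (p q : MvPolynomial (Fin N) ℝ) :
    WW e (p * q) = p * WW e q + q * WW e p := by
  simp only [WW, Derivation.leibniz, smul_eq_mul, mul_sub, Finset.mul_sum, mul_add,
    Finset.sum_add_distrib]
  have h : ∀ p q : MvPolynomial (Fin N) ℝ, ∑ j, X j * (p * pderiv j q) = ∑ j, p * (X j * pderiv j q) :=
    fun p q => Finset.sum_congr rfl fun j _ => by ring
  rw [h, h]; ring

theorem WW_RR (e : Fin N → ℝ) (he : ∑ j, e j ^ 2 = 1) : WW e (RR e) = 2 * RR e := by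
  rw [WW, De_RR e he]
  simp only [pderiv_RR, mul_sub, Finset.sum_sub_distrib]
  have h1 : ∑ j, (X j * (2 * X j) : MvPolynomial (Fin N) ℝ) = 2 * ∑ j, X j * X j := by
    rw [Finset.mul_sum]; exact Finset.sum_congr rfl fun j _ => by ring
  have h2 : ∑ j, (X j * (2 * (C (e j) * aa e)) : MvPolynomial (Fin N) ℝ) = 2 * (aa e * aa e) := by
    conv_rhs => rw [← mul_assoc, mul_comm 2]; arg 1; arg 1; rw [aa]
    rw [Finset.sum_mul, Finset.sum_mul]
    exact Finset.sum_congr rfl fun j _ => by rw [MvPolynomial.smul_eq_C_mul]; ring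
  rw [h1, h2, RR]; ring

theorem WW_RR_pow (e : Fin N → ℝ) (he : ∑ j, e j ^ 2 = 1) (l : ℕ) :
    WW e (RR e ^ l) = (2 * l : MvPolynomial (Fin N) ℝ) * RR e ^ l := by
  induction l with
  | zero => simp [WW]
  | succ l ih => rw [pow_succ, WW_mul, ih, WW_RR e he]; push_cast; ring

theorem Lap_RR (e : Fin N → ℝ) (he : ∑ j, e j ^ 2 = 1) :
    Lap e (RR e) = 2 * (N : MvPolynomial (Fin N) ℝ) - 2 := by
  rw [Lap, De_RR e he]
  have h0 : ∀ j : Fin N, pderiv j (2 : MvPolynomial (Fin N) ℝ) = 0 := fun j =>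
    (pderiv j).map_natCast 2
  simp only [pderiv_RR, map_sub, pderiv_mul, pderiv_aa, pderiv_C, h0, pderiv_X_self]
  simp only [zero_mul, zero_add, mul_one, map_zero, sub_zero, Finset.sum_sub_distrib,
    ← Finset.mul_sum]
  have h : ∑ j, (C (e j) * C (e j) : MvPolynomial (Fin N) ℝ) = C (∑ j, e j ^ 2) := by
    rw [map_sum]; exact Finset.sum_congr rfl fun j _ => by rw [pow_two, C_mul]
  rw [h, he]
  simp; ring

theorem Lap_RR_mul (e : Fin N → ℝ) (he : ∑ j, e j ^ 2 = 1) (q : MvPolynomial (Fin N) ℝ) :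
    Lap e (RR e * q) = RR e * Lap e q + 4 * WW e q + (2 * (N : MvPolynomial (Fin N) ℝ) - 2) * q := by
  rw [Lap_mul, De_RR e he, Lap_RR e he]
  have : ∑ j, pderiv j (RR e) * pderiv j q = 2 * WW e q := by
    simp only [pderiv_RR, WW, De_apply, mul_sub, Finset.mul_sum, ← Finset.sum_sub_distrib]
    exact Finset.sum_congr rfl fun j _ => by rw [MvPolynomial.smul_eq_C_mul]; ring
  rw [this]; ring

theorem Lap_RR_pow (e : Fin N → ℝ) (he : ∑ j, e j ^ 2 = 1) (l : ℕ) :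
    Lap e (RR e ^ (l+1)) = (2 * (l+1) * (N - 1 + 2 * l) : ℝ) • RR e ^ l := by
  have h2 : (C 2 : MvPolynomial (Fin N) ℝ) = 2 := map_ofNat C 2
  induction l with
  | zero => simp [Lap_RR e he, MvPolynomial.smul_eq_C_mul, h2]; ring
  | succ l ih =>
    rw [pow_succ', Lap_RR_mul e he, ih, WW_RR_pow e he]
    simp only [MvPolynomial.smul_eq_C_mul]
    simp [h2]; ring

theorem Lap_main (e : Fin N → ℝ) (he : ∑ j, e j ^ 2 = 1) (m l : ℕ) :
    Lap e (aa e ^ m * RR e ^ (l+1)) = (2 * (l+1) * (N - 1 + 2 * l) : ℝ) • (aa e ^ m * RR e ^ l) := by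
  induction m with
  | zero => simp [Lap_RR_pow e he]
  | succ m ih => rw [pow_succ', mul_assoc, Lap_aa_mul e he, ih, mul_smul_comm]; congr 1; ring

theorem Lap_aa_pow (e : Fin N → ℝ) (he : ∑ j, e j ^ 2 = 1) (m : ℕ) :
    Lap e (aa e ^ m) = 0 := by
  induction m with
  | zero => simp [Lap]
  | succ m ih => rw [pow_succ', Lap_aa_mul e he, ih, mul_zero]

theorem BB_aa (e : Fin N → ℝ) (he : ∑ j, e j ^ 2 = 1) (m : ℕ) :
    BB m (aa e ^ m) (aa e ^ m) = (m.factorial : ℝ) * m.factorial := by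
  induction m with
  | zero => simp [BB_zero]
  | succ m ih =>
    have : De e (aa e ^ (m+1)) = ((m:ℝ)+1) • aa e ^ m := by
      rw [Derivation.leibniz_pow, De_aa e he]
      simp [MvPolynomial.smul_eq_C_mul]
    rw [pow_succ', BB_adja, ← pow_succ', this, BB_smul_right, ih, Nat.factorial_succ]
    push_cast; ring

theorem BB_offdiag (e : Fin N → ℝ) (he : ∑ j, e j ^ 2 = 1) (l d m m' : ℕ)  :
    BB (m + 2 * l) (aa e ^ m * RR e ^ l) (aa e ^ m' * RR e ^ (l + d + 1)) = 0 ∨ m ≠ m' + 2 * (d+1) := by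
  by_cases hm : m = m' + 2 * (d+1)
  swap
  · exact Or.inr hm
  left
  induction l with
  | zero =>
    rw [BB_symm, show m + 2 * 0 = (m' + 2*d) + 2 by omega, pow_succ',
      show aa e ^ m' * (RR e * RR e ^ (0+d)) = RR e * (aa e ^ m' * RR e ^ (0+d)) by ring, BB_adjR]
    simp [Lap_aa_pow e he, BB]
  | succ l ih =>
    rw [pow_succ' (RR e) l, show aa e ^ m * (RR e * RR e ^ l) = RR e * (aa e ^ m * RR e ^ l) by ring,
      show m + 2 * (l+1) = (m + 2 * l) + 2 by ring, BB_adjR, Lap_main e he, BB_smul_right,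
      show l + 1 + d = l + d + 1 by ring, ih]
    simp

theorem BB_diag (e : Fin N → ℝ) (he : ∑ j, e j ^ 2 = 1) (l m : ℕ)  :
    BB (m + 2 * l) (aa e ^ m * RR e ^ l) (aa e ^ m * RR e ^ l) =
      ((m + 2 * l).factorial : ℝ) * m.factorial * 4 ^ l * l.factorial * ffac (((N:ℝ) - 3)/2 + l) l := by
  induction l with
  | zero => simp [BB_aa e he, ffac]
  | succ l ih =>
    nth_rewrite 1 [pow_succ' (RR e) l]
    rw [show aa e ^ m * (RR e * RR e ^ l) = RR e * (aa e ^ m * RR e ^ l) by ring,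
      show m + 2 * (l+1) = (m + 2 * l) + 2 by ring, BB_adjR, Lap_main e he, BB_smul_right, ih]
    have : ffac (((N:ℝ) - 3)/2 + ((l+1:ℕ):ℝ)) (l+1) = (((N:ℝ) - 3)/2 + l + 1) * ffac (((N:ℝ) - 3)/2 + l) l := by
      unfold ffac
      rw [Finset.prod_range_succ']
      rw [mul_comm]
      congr 1
      · push_cast; ring
      · exact Finset.prod_congr rfl fun i _ => by push_cast; ring
    rw [this, Nat.factorial_succ (m + 2*l+1), Nat.factorial_succ (m + 2*l), Nat.factorial_succ l]
    push_cast; ring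

end Fischer

section Calculus
variable {N : ℕ}

noncomputable def VV (v : EuclideanSpace ℝ (Fin N)) : MvPolynomial (Fin N) ℝ := ∑ j, (2 * v j) • X j
noncomputable def AA (y : EuclideanSpace ℝ (Fin N)) : MvPolynomial (Fin N) ℝ :=
  ∑ j, X j * X j + VV y

theorem VV_single (j : Fin N) : VV (EuclideanSpace.single j (1:ℝ)) = 2 * X j := by
  unfold VV
  rw [Finset.sum_eq_single j]
  · simp [MvPolynomial.smul_eq_C_mul, map_ofNat C 2]
  · intro i _ h; simp [h]
  · simp

theorem L_mul_AA (L : MvPolynomial (Fin N) ℝ →ₗ[ℝ] ℝ) (p : MvPolynomial (Fin N) ℝ)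
    (z : EuclideanSpace ℝ (Fin N)) :
    L (p * AA z) = L (p * ∑ j, X j * X j) + ∑ j, 2 * z j * L (p * X j) := by
  rw [AA, mul_add, map_add, VV, Finset.mul_sum _ (fun j => (2 * z j) • (X j : MvPolynomial (Fin N) ℝ)),
    map_sum]
  congr 1
  refine Finset.sum_congr rfl fun j _ => ?_
  rw [mul_smul_comm, map_smul, smul_eq_mul]

theorem AA_diff (n : ℕ) (y : EuclideanSpace ℝ (Fin N)) :
    ∀ L : MvPolynomial (Fin N) ℝ →ₗ[ℝ] ℝ, ∃ D : EuclideanSpace ℝ (Fin N) →L[ℝ] ℝ,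
      HasFDerivAt (fun y => L (AA y ^ n)) D y ∧ ∀ v, D v = n * L (VV v * AA y ^ (n-1)) := by
  induction n with
  | zero =>
    intro L
    refine ⟨0, ?_, by simp⟩
    simpa using hasFDerivAt_const _ _
  | succ n ih =>
    intro L
    obtain ⟨D0, h0, h0'⟩ := ih (L.comp (LinearMap.mulRight ℝ (∑ j, X j * X j)))
    choose D h h' using fun j : Fin N => ih (L.comp (LinearMap.mulRight ℝ (X j)))
    have hp : ∀ j : Fin N, HasFDerivAt (fun y : EuclideanSpace ℝ (Fin N) => 2 * y j)
        ((2:ℝ) • (EuclideanSpace.proj j : EuclideanSpace ℝ (Fin N) →L[ℝ] ℝ)) y := by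
      intro j
      exact ((EuclideanSpace.proj j : EuclideanSpace ℝ (Fin N) →L[ℝ] ℝ).hasFDerivAt).const_mul 2
    have H := h0.add (HasFDerivAt.fun_sum (u := Finset.univ) fun j _ => (hp j).mul (h j))
    refine ⟨_, H.congr_of_eventuallyEq (Filter.Eventually.of_forall fun z => ?_), fun v => ?_⟩
    · simp only [LinearMap.comp_apply, LinearMap.mulRight_apply, Pi.add_apply, Pi.mul_apply]
      rw [pow_succ, L_mul_AA]
    · simp only [add_apply, sum_apply, h0', h',
        smul_apply, LinearMap.comp_apply, LinearMap.mulRight_apply, smul_eq_mul]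
      have e1 : (n:ℝ) * L (VV v * AA y ^ (n-1) * ∑ j, X j * X j) +
          ∑ j, 2 * y j * (n * L (VV v * AA y ^ (n-1) * X j)) = n * L (VV v * AA y ^ n) := by
        cases n with
        | zero => simp
        | succ m =>
          rw [pow_succ, ← mul_assoc, L_mul_AA, mul_add, Finset.mul_sum _ (fun j => 2 * y j * _)]
          congr 1
          exact Finset.sum_congr rfl fun j _ => by simp only [Nat.add_sub_cancel]; ring
      have e2 : ∑ j, L (AA y ^ n * X j) * (2 * v j) = L (VV v * AA y ^ n) := by
        rw [VV, Finset.sum_mul, map_sum]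
        refine Finset.sum_congr rfl fun j _ => ?_
        rw [smul_mul_assoc, map_smul, mul_comm (X j), smul_eq_mul, mul_comm]
      rw [Finset.sum_add_distrib, ← add_assoc, e1]
      change _ + ∑ j, L (AA y ^ n * X j) * (2 * v j) = _
      rw [e2]
      push_cast; ring

theorem pderiv_AA (y : EuclideanSpace ℝ (Fin N)) (j : Fin N) :
    pderiv j (AA y) = 2 * X j + C (2 * y j) := by
  have : ∀ i : Fin N, pderiv j (X i * X i : MvPolynomial (Fin N) ℝ) = if i = j then 2 * X j else 0 := by
    intro i
    by_cases h : i = j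
    · subst h; simp; ring
    · simp [pderiv_X_of_ne h, h]
  simp only [AA, VV, map_add, map_sum, this]
  simp [pderiv_X, Pi.single_apply, MvPolynomial.smul_eq_C_mul]

theorem aeval_AA (y : EuclideanSpace ℝ (Fin N)) :
    MvPolynomial.aeval (0 : Fin N → ℝ) (AA y) = 0 := by
  simp [AA, VV]

theorem Lf_AA_zero (y : EuclideanSpace ℝ (Fin N)) (i : List (Fin N)) :
    ∀ (n : ℕ), i.length < n → ∀ p, Lf i (AA y ^ n * p) = 0 := by
  induction i with
  | nil =>
    intro n hn p
    have : n ≠ 0 := by simp at hn; omega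
    rw [Lf_nil, map_mul, map_pow, aeval_AA]; simp [this]
  | cons j i ih =>
    intro n hn p
    obtain ⟨m, rfl⟩ : ∃ m, n = m + 1 := ⟨n - 1, by simp at hn; omega⟩
    rw [Lf_cons, pderiv_mul, pderiv_pow,
      show ((m+1 : ℕ) : MvPolynomial (Fin N) ℝ) * AA y ^ (m+1-1) * pderiv j (AA y) * p + AA y ^ (m+1) * pderiv j p
        = AA y ^ m * (((m+1 : ℕ) : MvPolynomial (Fin N) ℝ) * pderiv j (AA y) * p + AA y * pderiv j p) by
        simp; ring]
    exact ih m (by simp at hn; omega) _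

theorem ffac_succ (ν : ℝ) (n : ℕ) : ffac ν (n+1) = ffac ν n * (ν - n) := by
  simp [ffac, Finset.prod_range_succ]

theorem gchoose_succ (ν : ℝ) (n : ℕ) : gchoose ν (n+1) * (n+1) = gchoose ν n * (ν - n) := by
  unfold gchoose
  rw [ffac_succ, Nat.factorial_succ]
  have : (n.factorial : ℝ) ≠ 0 := by positivity
  have : (n : ℝ) + 1 ≠ 0 := by positivity
  push_cast
  field_simp

theorem gchoose_nat (n m : ℕ) : gchoose (n : ℝ) m = (n.choose m : ℝ) := by
  have h : ffac (n : ℝ) m = (n.descFactorial m : ℝ) := by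
    induction m with
    | zero => simp [ffac]
    | succ m ih =>
      rw [ffac_succ, ih, Nat.descFactorial_succ]
      rcases le_or_gt m n with h | h
      · push_cast [Nat.cast_sub h]; ring
      · rw [Nat.descFactorial_of_lt h]; simp
  have : (m.factorial : ℝ) ≠ 0 := by positivity
  rw [gchoose, h, Nat.descFactorial_eq_factorial_mul_choose]
  push_cast; field_simp

theorem pdIter_formula (s : ℝ) (i : List (Fin N)) :
    ∀ (M : ℕ), i.length < M → ∀ y : EuclideanSpace ℝ (Fin N), y ≠ 0 →
    pdIter i (fun y => ‖y‖ ^ s) y =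
      ∑ n ∈ Finset.range M, gchoose (s/2) n * (‖y‖^2) ^ (s/2 - n) * Lf i (AA y ^ n) := by
  induction i with
  | nil =>
    intro M hM y hy
    obtain ⟨M, rfl⟩ : ∃ m, M = m + 1 := ⟨M - 1, by simp at hM; omega⟩
    rw [Finset.sum_range_succ']
    simp only [Lf_nil, map_pow, aeval_AA]
    simp [pdIter, gchoose, ffac]
    rw [← Real.rpow_natCast, ← Real.rpow_mul (norm_nonneg _)]
    congr 1; push_cast; ring
  | cons j i ih =>
    intro M hM y hy
    obtain ⟨M, rfl⟩ : ∃ m, M = m + 1 := ⟨M - 1, by simp at hM; omega⟩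
    have hlen : i.length < M := by simpa using hM
    have hQ : ‖y‖^2 ≠ 0 := by simpa using hy
    have hev : pdIter i (fun y => ‖y‖ ^ s) =ᶠ[nhds y] fun y =>
        ∑ n ∈ Finset.range (M+1), gchoose (s/2) n * (‖y‖^2) ^ (s/2 - n) * Lf i (AA y ^ n) := by
      filter_upwards [isOpen_ne.mem_nhds hy] with z hz
      exact ih (M+1) (by omega) z hz
    change fderiv ℝ (pdIter i (fun y => ‖y‖ ^ s)) y _ = _
    rw [hev.fderiv_eq]
    choose D h h' using fun n : ℕ => AA_diff n y (Lf i)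
    have hn := fun n : ℕ => ((hasStrictFDerivAt_norm_sq y).hasFDerivAt.rpow_const
      (p := s/2 - n) (Or.inl hQ)).const_mul (gchoose (s/2) n)
    have H := HasFDerivAt.fun_sum (u := Finset.range (M+1)) fun n _ => (hn n).mul (h n)
    have H2 := H.fderiv
    simp only [Pi.mul_apply] at H2
    rw [H2]
    simp only [add_apply, sum_apply, h',
        smul_apply, smul_eq_mul, VV_single, innerSL_apply_apply, Lf_cons]
    have hin : inner ℝ y (EuclideanSpace.single j (1:ℝ)) = y j := by
      simp [EuclideanSpace.inner_single_right]
    rw [hin]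
    have e1 : ∀ n : ℕ, Lf i (pderiv j (AA y ^ n)) =
        n * Lf i (2 * X j * AA y ^ (n-1)) + n * (2 * y j) * Lf i (AA y ^ (n-1)) := by
      intro n
      rw [pderiv_pow, pderiv_AA, show (n : MvPolynomial (Fin N) ℝ) * AA y ^ (n-1) * (2 * X j + C (2 * y j))
        = (n:ℝ) • (2 * X j * AA y ^ (n-1)) + ((n:ℝ) * (2 * y j)) • AA y ^ (n-1) by
          simp only [MvPolynomial.smul_eq_C_mul, map_mul, map_natCast]; ring]
      simp
    simp only [e1, mul_add, Finset.sum_add_distrib]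
    congr 1
    rw [Finset.sum_range_succ, Finset.sum_range_succ']
    have := Lf_AA_zero y i M hlen 1
    rw [mul_one] at this
    rw [this]
    simp only [zero_mul, add_zero, Nat.cast_zero, mul_zero]
    refine Finset.sum_congr rfl fun n _ => ?_
    have g := gchoose_succ (s/2) n
    simp only [Nat.add_sub_cancel, nsmul_eq_mul]
    rw [show s/2 - ((n+1 : ℕ):ℝ) = s/2 - n - 1 by push_cast; ring]
    push_cast
    linear_combination (-(2 * y j) * (‖y‖^2) ^ (s/2 - n - 1) * Lf i (AA y ^ n)) * g

theorem Lf_homog (i : List (Fin N)) : ∀ (d : ℕ) (p : MvPolynomial (Fin N) ℝ), p.IsHomogeneous d →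
    d ≠ i.length → Lf i p = 0 := by
  induction i with
  | nil =>
    intro d p hp hd
    rw [Lf_nil]
    have h := hp.coeff_eq_zero (d := 0) (by simpa using hd.symm)
    rw [← MvPolynomial.constantCoeff_eq] at h
    rw [← h, MvPolynomial.constantCoeff_eq, MvPolynomial.aeval_zero, MvPolynomial.constantCoeff_eq]
    rfl
  | cons j i ih =>
    intro d p hp hd
    rw [Lf_cons]
    rcases d with _ | d
    · have : p = C (coeff 0 p) := by
        rw [← MvPolynomial.totalDegree_eq_zero_iff_eq_C]
        exact Nat.le_zero.mp hp.totalDegree_le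
      rw [this, pderiv_C, map_zero]
    · exact ih d _ hp.pderiv (by simpa using hd)

end Calculus

section Final
variable {N : ℕ}

theorem aa_homog (e : Fin N → ℝ) : (aa e).IsHomogeneous 1 := by
  unfold aa
  refine MvPolynomial.IsHomogeneous.sum _ _ _ fun j _ => ?_
  rw [MvPolynomial.smul_eq_C_mul]
  simpa using (MvPolynomial.isHomogeneous_C _ (e j)).mul (MvPolynomial.isHomogeneous_X ℝ j)

theorem QQ_homog : (∑ j, X j * X j : MvPolynomial (Fin N) ℝ).IsHomogeneous 2 :=
  MvPolynomial.IsHomogeneous.sum _ _ _ fun j _ =>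
    (MvPolynomial.isHomogeneous_X ℝ j).mul (MvPolynomial.isHomogeneous_X ℝ j)

theorem Lf_AA_pow (k n : ℕ) (hn : n ≤ k) (i : List (Fin N)) (hi : i.length = k) (e : Fin N → ℝ) (r : ℝ)
    (y : EuclideanSpace ℝ (Fin N)) (hy : ∀ j, y j = r * e j) :
    Lf i (AA y ^ n) = (n.choose (k - n) : ℝ) * (2 * r) ^ (2 * n - k) *
      Lf i ((∑ j, X j * X j) ^ (k - n) * aa e ^ (2 * n - k)) := by
  have h1 : AA y = ∑ j, X j * X j + (2 * r) • aa e := by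
    rw [AA, VV, aa, Finset.smul_sum]
    congr 1
    exact Finset.sum_congr rfl fun j _ => by rw [hy, smul_smul]; congr 1; ring
  rw [h1, add_pow, map_sum]
  have h2 : ∀ m ∈ Finset.range (n+1), Lf i ((∑ j, X j * X j) ^ m * ((2 * r) • aa e) ^ (n - m) *
      ((n.choose m : ℕ) : MvPolynomial (Fin N) ℝ)) =
      (n.choose m : ℝ) * (2 * r) ^ (n - m) * Lf i ((∑ j, X j * X j) ^ m * aa e ^ (n - m)) := by
    intro m _
    rw [smul_pow, show (∑ j, X j * X j) ^ m * ((2 * r) ^ (n-m) • aa e ^ (n - m)) *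
      ((n.choose m : ℕ) : MvPolynomial (Fin N) ℝ) = ((n.choose m : ℝ) * (2 * r) ^ (n - m)) •
        ((∑ j, X j * X j) ^ m * aa e ^ (n - m)) by
          simp only [MvPolynomial.smul_eq_C_mul, map_mul, map_natCast]; ring]
    rw [map_smul, smul_eq_mul]
  rw [Finset.sum_congr rfl h2]
  have h3 : ∀ m ∈ Finset.range (n+1), m ≠ k - n → (n.choose m : ℝ) * (2 * r) ^ (n - m) *
      Lf i ((∑ j, X j * X j) ^ m * aa e ^ (n - m)) = 0 := by
    intro m hm hmk
    rw [Lf_homog i (2 * m + 1 * (n - m)) _ ((QQ_homog.pow m).mul ((aa_homog e).pow (n-m))), mul_zero]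
    simp at hm
    omega
  by_cases hk : k ≤ 2 * n
  · rw [Finset.sum_eq_single_of_mem (k - n) (by simp; omega) h3,
      show n - (k - n) = 2 * n - k by omega]
  · rw [Nat.choose_eq_zero_of_lt (by omega : n < k - n)]
    simp only [Nat.cast_zero, zero_mul]
    refine Finset.sum_eq_zero fun m hm => h3 m hm ?_
    simp at hm; omega

noncomputable def dd (s : ℝ) (k l : ℕ) : ℝ := ∑ n ∈ Finset.Icc ((k + 1) / 2) (k - l),
  (2 : ℝ) ^ (2 * n - k) * gchoose (s / 2) n * (n.choose (k - n) : ℝ) * ((k - n).choose l : ℝ)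

theorem pd_final (k : ℕ) (i : List (Fin N)) (hi : i.length = k) (e : Fin N → ℝ) (s r : ℝ) (hr : 0 < r)
    (y : EuclideanSpace ℝ (Fin N)) (hy : ∀ j, y j = r * e j) (hyr : ‖y‖ = r) :
    pdIter i (fun y => ‖y‖ ^ s) y =
      r ^ (s - k) * Lf i (∑ l ∈ Finset.range (k/2+1), dd s k l • (aa e ^ (k - 2 * l) * RR e ^ l)) := by
  have hy0 : y ≠ 0 := by
    rintro rfl
    rw [norm_zero] at hyr; exact hr.ne hyr
  rw [pdIter_formula s i (k+1) (by omega) y hy0, hyr]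
  -- expand each term
  have h1 : ∀ n ∈ Finset.Icc ((k+1)/2) k, gchoose (s/2) n * (r^2) ^ (s/2 - n) * Lf i (AA y ^ n) =
      r ^ (s - k) * ∑ l ∈ Finset.range (k/2+1), ((2 : ℝ) ^ (2 * n - k) * gchoose (s / 2) n *
        (n.choose (k - n) : ℝ) * ((k - n).choose l : ℝ)) * Lf i (aa e ^ (k - 2 * l) * RR e ^ l) := by
    intro n hn
    rw [Finset.mem_Icc] at hn
    rw [Lf_AA_pow k n hn.2 i hi e r y hy]
    have hQ : (∑ j, X j * X j : MvPolynomial (Fin N) ℝ) = RR e + aa e * aa e := by rw [RR]; ring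
    have h2 : Lf i ((∑ j, X j * X j) ^ (k - n) * aa e ^ (2 * n - k)) =
        ∑ l ∈ Finset.range (k/2+1), ((k - n).choose l : ℝ) * Lf i (aa e ^ (k - 2 * l) * RR e ^ l) := by
      rw [hQ, add_pow, Finset.sum_mul, map_sum]
      have : Finset.range (k - n + 1) ⊆ Finset.range (k/2+1) := by
        intro l; simp; omega
      rw [← Finset.sum_subset this]
      · refine Finset.sum_congr rfl fun l hl => ?_
        simp at hl
        rw [show k - 2 * l = 2 * (k - n - l) + (2 * n - k) by omega,
          show RR e ^ l * (aa e * aa e) ^ (k - n - l) * (((k-n).choose l : ℕ) : MvPolynomial (Fin N) ℝ)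
            * aa e ^ (2 * n - k) = (((k-n).choose l : ℕ) : ℝ) •
              (aa e ^ (2 * (k - n - l) + (2 * n - k)) * RR e ^ l) by
            simp only [MvPolynomial.smul_eq_C_mul, map_natCast]; ring]
        rw [map_smul, smul_eq_mul]
      · intro l _ hl
        simp at hl
        rw [Nat.choose_eq_zero_of_lt (by omega)]; simp
    have h3 : (r^2) ^ (s/2 - n) * r ^ (2 * n - k) = r ^ (s - k) := by
      rw [← Real.rpow_natCast, ← Real.rpow_natCast, ← Real.rpow_mul hr.le, ← Real.rpow_add hr]
      congr 1
      rw [Nat.cast_sub (by omega)]; push_cast; ring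
    rw [h2, ← h3, mul_pow, Finset.mul_sum, Finset.mul_sum, Finset.mul_sum]
    exact Finset.sum_congr rfl fun l _ => by ring
  have hsub : Finset.Icc ((k+1)/2) k ⊆ Finset.range (k+1) := by
    intro n; simp
  rw [← Finset.sum_subset hsub, Finset.sum_congr rfl h1, ← Finset.mul_sum, Finset.sum_comm, map_sum]
  · congr 1
    refine Finset.sum_congr rfl fun l _ => ?_
    rw [map_smul, smul_eq_mul, dd, Finset.sum_mul]
    symm
    apply Finset.sum_subset
    · intro n; simp; omega
    · intro n hn hn'
      simp at hn hn'
      rw [Nat.choose_eq_zero_of_lt (by omega : k - n < l)]; simp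
  · intro n hn hn'
    simp at hn hn'
    rw [Lf_AA_pow k n (by omega) i hi e r y hy, Nat.choose_eq_zero_of_lt (by omega : n < k - n)]
    simp

theorem BB_off (e : Fin N → ℝ) (he : ∑ j, e j ^ 2 = 1) (k l l' : ℕ) (hl : 2 * l ≤ k) (hl' : 2 * l' ≤ k)
    (h : l ≠ l') :
    BB k (aa e ^ (k - 2 * l) * RR e ^ l) (aa e ^ (k - 2 * l') * RR e ^ l') = 0 := by
  wlog hlt : l < l' generalizing l l'
  · rw [BB_symm]; exact this l' l hl' hl h.symm (by omega)
  obtain ⟨d, rfl⟩ : ∃ d, l' = l + d + 1 := ⟨l' - l - 1, by omega⟩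
  have := BB_offdiag e he l d (k - 2 * l) (k - 2 * (l + d + 1))
  rw [show k - 2 * l + 2 * l = k by omega] at this
  rcases this with h | h
  · exact h
  · omega

end Final

theorem stmt_2 (N : ℕ) (hN : 0 < N) (k : ℕ) (s : ℝ)
    (x : EuclideanSpace ℝ (Fin N)) (hx : x ≠ 0) :
    ‖x‖ ^ (2 * ((k : ℝ) - s)) * gradSq N k (fun y => ‖y‖ ^ s) x =
      (Nat.factorial k : ℝ) *
        ∑ l ∈ Finset.range (k / 2 + 1),
          (Nat.factorial (k - 2 * l) : ℝ) * (Nat.factorial l : ℝ) *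
            ffac (((N : ℝ) - 3) / 2 + l) l *
            (∑ n ∈ Finset.Icc ((k + 1) / 2) (k - l),
              (2 : ℝ) ^ (2 * n - k + l) * gchoose (s / 2) n * gchoose (n : ℝ) (k - n) *
                gchoose ((k - n : ℕ) : ℝ) l) ^ 2 := by
  have hr : 0 < ‖x‖ := norm_pos_iff.mpr hx
  set r := ‖x‖ with hrdef
  let e : Fin N → ℝ := fun j => x j / r
  have hy : ∀ j, x j = r * e j := fun j => by simp only [e]; field_simp
  have he : ∑ j, e j ^ 2 = 1 := by
    simp only [e, div_pow, ← Finset.sum_div]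
    rw [← EuclideanSpace.real_norm_sq_eq, ← hrdef]
    exact div_self (by positivity)
  set P : MvPolynomial (Fin N) ℝ :=
    ∑ l ∈ Finset.range (k/2+1), dd s k l • (aa e ^ (k - 2 * l) * RR e ^ l) with hP
  have h1 : gradSq N k (fun y => ‖y‖ ^ s) x = (r ^ (s - k)) ^ 2 * BB k P P := by
    rw [gradSq, BB, Finset.mul_sum]
    refine Finset.sum_congr rfl fun i _ => ?_
    rw [pd_final k (List.ofFn i) (by simp) e s r hr x hy rfl]
    ring
  have h2 : r ^ (2 * ((k : ℝ) - s)) * (r ^ (s - k)) ^ 2 = 1 := by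
    rw [← Real.rpow_natCast, ← Real.rpow_mul hr.le, ← Real.rpow_add hr]
    rw [show 2 * ((k : ℝ) - s) + (s - k) * ((2:ℕ):ℝ) = 0 by push_cast; ring, Real.rpow_zero]
  rw [h1, ← mul_assoc, h2, one_mul, hP, BB_sum_left, Finset.mul_sum]
  refine Finset.sum_congr rfl fun l hl => ?_
  have hl2 : 2 * l ≤ k := by simp at hl; omega
  rw [BB_smul_left, BB_sum_right, Finset.sum_eq_single_of_mem l hl]
  · rw [BB_smul_right]
    have := BB_diag e he l (k - 2 * l)
    rw [show k - 2 * l + 2 * l = k by omega] at this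
    rw [this]
    have h3 : ∑ n ∈ Finset.Icc ((k + 1) / 2) (k - l),
              (2 : ℝ) ^ (2 * n - k + l) * gchoose (s / 2) n * gchoose (n : ℝ) (k - n) *
                gchoose ((k - n : ℕ) : ℝ) l = 2 ^ l * dd s k l := by
      rw [dd, Finset.mul_sum]
      exact Finset.sum_congr rfl fun n _ => by rw [gchoose_nat, gchoose_nat, pow_add]; ring
    rw [h3, show (4:ℝ) ^ l = (2 ^ l) ^ 2 by rw [← pow_mul, mul_comm, pow_mul]; norm_num]
    ring
  · intro l' hl' hne
    rw [BB_smul_right, BB_off e he k l l' hl2 (by simp at hl'; omega) hne.symm, mul_zero]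
end

section
/- Let N and k be positive integers. Then for every x ∈ ℝ^N \ {0}, |x|^{2k} · |∇_N^k v(x)|² = k! · Σ_{l=0}^{⌊k/2⌋} (k−2l)! · l! · ((N−3)/2 + l)_l · ( Σ_{n=⌈k/2⌉}^{k−l} 2^{2n−k+l} · ((−1)^n/(2n)) · C(n, k−n) · C(k−n, l) )², where v(x) = log|x|. -/
open scoped BigOperators

open MvPolynomial

set_option linter.unusedSimpArgs false
set_option autoImplicit false

namespace Aux
variable {N : ℕ}

abbrev MP (N : ℕ) := MvPolynomial (Fin N) ℝ

noncomputable def cc : MP N →ₗ[ℝ] ℝ := (MvPolynomial.aeval (R := ℝ) (fun _ : Fin N => (0:ℝ))).toLinearMap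

noncomputable def phi : List (Fin N) → MP N →ₗ[ℝ] ℝ
  | [] => cc
  | i :: l => (phi l).comp (pderiv (R := ℝ) i).toLinearMap

noncomputable def B : ℕ → MP N →ₗ[ℝ] MP N →ₗ[ℝ] ℝ
  | 0 => (LinearMap.mul ℝ ℝ).compl₁₂ cc cc
  | k + 1 => ∑ a : Fin N, (B k).compl₁₂ (pderiv (R := ℝ) a).toLinearMap (pderiv (R := ℝ) a).toLinearMap

lemma B_zero (p q : MP N) : B 0 p q = cc p * cc q := by simp [B]

lemma B_succ (k : ℕ) (p q : MP N) : B (k+1) p q = ∑ a, B k (pderiv a p) (pderiv a q) := by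
  simp [B, LinearMap.sum_apply]

lemma B_symm (k : ℕ) (p q : MP N) : B k p q = B k q p := by
  induction k generalizing p q with
  | zero => simp [B_zero, mul_comm]
  | succ k ih => simp only [B_succ]; exact Finset.sum_congr rfl fun a _ => ih _ _

lemma B_eq_sum (k : ℕ) (p q : MP N) :
    B k p q = ∑ i : Fin k → Fin N, phi (List.ofFn i) p * phi (List.ofFn i) q := by
  induction k generalizing p q with
  | zero => simp [B_zero, phi]
  | succ k ih =>
    rw [B_succ, ← (Fin.consEquiv (fun _ : Fin (k+1) => Fin N)).sum_comp, Fintype.sum_prod_type]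
    refine Finset.sum_congr rfl fun a _ => ?_
    rw [ih]
    refine Finset.sum_congr rfl fun i _ => ?_
    simp [List.ofFn_succ, phi, Fin.consEquiv]

lemma pderiv_comm (i j : Fin N) (p : MP N) :
    pderiv i (pderiv j p) = pderiv j (pderiv i p) := by
  have h : ⁅(pderiv i : Derivation ℝ (MP N) (MP N)), (pderiv j : Derivation ℝ (MP N) (MP N))⁆ = 0 := by
    apply MvPolynomial.derivation_ext
    intro k
    simp [Derivation.commutator_apply, pderiv_X, Pi.single_apply]
    split_ifs <;> simp
  have h2 := congrArg (fun D => D p) h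
  simp only [Derivation.commutator_apply, Derivation.zero_apply] at h2
  exact sub_eq_zero.mp h2

lemma B_X_mul (k : ℕ) (j : Fin N) (p q : MP N) :
    B (k+1) (X j * p) q = (k+1 : ℝ) * B k p (pderiv j q) := by
  induction k generalizing p q with
  | zero =>
    simp only [B_succ, B_zero]
    rw [Finset.sum_eq_single j]
    · simp [cc]
    · intro b _ hb
      simp [cc, Derivation.leibniz, pderiv_X, Pi.single_apply, hb.symm, hb]
    · simp
  | succ k ih =>
    rw [B_succ]
    have h : ∀ a, B (k+1) (pderiv a (X j * p)) (pderiv a q) =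
        (if a = j then B (k+1) p (pderiv j q) else 0)
          + (k+1:ℝ) * B k (pderiv a p) (pderiv a (pderiv j q)) := by
      intro a
      rw [Derivation.leibniz, map_add, LinearMap.add_apply, smul_eq_mul, ih, pderiv_comm a j q]
      by_cases h : a = j
      · subst h; simp; ring
      · simp [h, pderiv_X, Pi.single_apply]
    simp only [h, Finset.sum_add_distrib, ← Finset.mul_sum, ← B_succ]
    simp
    ring

/-- the linear form -/
noncomputable def s (y : Fin N → ℝ) : MP N := ∑ i, C (y i) * X i

noncomputable def qq : MP N := ∑ i, X i * X i

noncomputable def w (y : Fin N → ℝ) : MP N := qq - s y * s y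

noncomputable def D (y : Fin N → ℝ) : Derivation ℝ (MP N) (MP N) := ∑ i, y i • pderiv i

noncomputable def L (y : Fin N → ℝ) (p : MP N) : MP N :=
  ∑ i, pderiv i (pderiv i p) - D y (D y p)

lemma D_apply (y : Fin N → ℝ) (p : MP N) : D y p = ∑ i, y i • pderiv i p := by
  have : ∀ t : Finset (Fin N), (∑ i ∈ t, y i • (pderiv i : Derivation ℝ (MP N) (MP N))) p
      = ∑ i ∈ t, y i • pderiv i p := by
    intro t
    induction t using Finset.cons_induction with
    | empty => simp
    | cons a t ha ih => rw [Finset.sum_cons, Finset.sum_cons, Derivation.add_apply, ih, Derivation.smul_apply]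
  exact this _

lemma B_s_mul (k : ℕ) (y : Fin N → ℝ) (p q : MP N) :
    B (k+1) (s y * p) q = (k+1 : ℝ) * B k p (D y q) := by
  simp only [s, D_apply, Finset.sum_mul, map_sum, LinearMap.sum_apply, mul_assoc, C_mul', map_smul,
    LinearMap.smul_apply, B_X_mul, Finset.mul_sum, smul_mul_assoc, smul_eq_mul]
  exact Finset.sum_congr rfl fun _ _ => by ring

lemma B_w_mul (k : ℕ) (y : Fin N → ℝ) (p q : MP N) :
    B (k+2) (w y * p) q = ((k+2) * (k+1) : ℝ) * B k p (L y q) := by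
  have h1 : w y * p = ∑ i, X i * (X i * p) - s y * (s y * p) := by
    simp only [w, qq, sub_mul, Finset.sum_mul, mul_assoc]
  rw [h1, map_sub, LinearMap.sub_apply, B_s_mul, B_s_mul, map_sum, LinearMap.sum_apply]
  simp only [B_X_mul, L, map_sub, map_sum, ← Finset.mul_sum]
  push_cast
  ring

lemma pderiv_s (y : Fin N → ℝ) (i : Fin N) : pderiv i (s y) = C (y i) := by
  simp only [s, map_sum, Derivation.leibniz, pderiv_C, smul_zero, add_zero, pderiv_X,
    Pi.single_apply, smul_eq_mul]
  simp

lemma pderiv_qq (i : Fin N) : pderiv i (qq : MP N) = 2 * X i := by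
  simp only [qq, map_sum, Derivation.leibniz, pderiv_X, Pi.single_apply, smul_eq_mul]
  simp [two_mul, Finset.sum_add_distrib]

lemma pderiv_w (y : Fin N → ℝ) (i : Fin N) :
    pderiv i (w y) = 2 * X i - 2 * C (y i) * s y := by
  rw [w, map_sub, pderiv_qq, Derivation.leibniz, pderiv_s]
  simp only [smul_eq_mul]; ring

lemma sumC {y : Fin N → ℝ} (hy : ∑ i, y i * y i = 1) : ∑ i, (C (y i) * C (y i) : MP N) = 1 := by
  simp only [← C_mul, ← map_sum, hy, C_1]

lemma D_s {y : Fin N → ℝ} (hy : ∑ i, y i * y i = 1) : D y (s y) = 1 := by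
  rw [D_apply, ← sumC hy]
  simp only [pderiv_s, smul_eq_C_mul]

lemma D_w {y : Fin N → ℝ} (hy : ∑ i, y i * y i = 1) : D y (w y) = 0 := by
  rw [D_apply]
  have : ∀ i, y i • pderiv i (w y) = 2 * (C (y i) * X i) - 2 * s y * (C (y i) * C (y i)) := by
    intro i; rw [pderiv_w, smul_eq_C_mul]; ring
  simp only [this, Finset.sum_sub_distrib, ← Finset.mul_sum, sumC hy]
  rw [s]; ring

lemma D_w_pow {y : Fin N → ℝ} (hy : ∑ i, y i * y i = 1) (m : ℕ) : D y (w y ^ m) = 0 := by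
  rw [Derivation.leibniz_pow, D_w hy]; simp

lemma L_w {y : Fin N → ℝ} (hy : ∑ i, y i * y i = 1) (m : ℕ) :
    L y (w y ^ (m+1)) = (4 * (m+1) * (((N:ℝ)-3)/2 + (m+1)) : ℝ) • w y ^ m := by
  rw [L, D_w_pow hy, map_zero, sub_zero]
  have h : ∀ i, pderiv i (pderiv i (w y ^ (m+1))) =
      ((m+1 : ℕ) * m : MP N) * w y ^ (m-1) *
        (4 * (X i * X i) - 8 * s y * (C (y i) * X i) + 4 * (s y * s y) * (C (y i) * C (y i)))
      + ((m+1:ℕ) : MP N) * w y ^ m * (2 - 2 * (C (y i) * C (y i))) := by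
    intro i
    have h2 : pderiv i (2 : MP N) = 0 := by
      have := Derivation.map_natCast (pderiv (R := ℝ) i) 2
      exact_mod_cast this
    have h3 : pderiv i ((m+1:ℕ) : MP N) = 0 := Derivation.map_natCast (pderiv (R := ℝ) i) (m+1)
    simp only [Derivation.leibniz_pow, Derivation.leibniz, pderiv_w, map_nsmul, map_sub, pderiv_s,
      pderiv_C, h2, h3, pderiv_X, Pi.single_eq_same, smul_eq_mul, nsmul_eq_mul, Nat.add_sub_cancel]
    push_cast
    ring
  simp only [h, Finset.sum_add_distrib, ← Finset.mul_sum, Finset.sum_sub_distrib, sumC hy]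
  have e1 : ∑ i, C (y i) * X i = s y := rfl
  have e2 : ∑ i : Fin N, (X i * X i : MP N) = qq := rfl
  have e3 : qq = w y + s y * s y := by simp [w]
  rw [e1, e2, e3, smul_eq_C_mul]
  have e4 : (C (4 * (m+1) * (((N:ℝ)-3)/2 + (m+1))) : MP N)
     = 2 * (m+1) * (N - 1) + 4 * (m+1) * m := by
    have : (4 * (m+1) * (((N:ℝ)-3)/2 + (m+1))) = 2 * (m+1) * (N - 1) + 4 * (m+1) * m := by ring
    rw [this]
    have c2 : (C 2 : MP N) = 2 := by exact_mod_cast map_natCast (C : ℝ →+* MP N) 2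
    have c4 : (C 4 : MP N) = 4 := by exact_mod_cast map_natCast (C : ℝ →+* MP N) 4
    simp [c2, c4]
  rw [e4]
  cases m with
  | zero => simp; ring
  | succ m => simp; ring

lemma ffac_succ (ν : ℝ) (l : ℕ) : ffac (ν + 1) (l+1) = (ν+1) * ffac ν l := by
  simp only [ffac, Finset.prod_range_succ']
  rw [mul_comm]; congr 1
  · simp
  · apply Finset.prod_congr rfl; intros; push_cast; ring

lemma B_w_w {y : Fin N → ℝ} (hy : ∑ i, y i * y i = 1) (l : ℕ) :
    B (2*l) (w y ^ l) (w y ^ l) =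
      (2*l).factorial * 4^l * l.factorial * ffac (((N:ℝ)-3)/2 + l) l := by
  induction l with
  | zero => simp [B_zero, ffac, cc]
  | succ l ih =>
    have : 2*(l+1) = 2*l+2 := by ring
    rw [this, pow_succ' (w y) l, B_w_mul, ← pow_succ', L_w hy, map_smul, ih]
    have e : ((N:ℝ)-3)/2 + ((l+1:ℕ):ℝ) = (((N:ℝ)-3)/2 + l) + 1 := by push_cast; ring
    rw [e, ffac_succ, Nat.factorial_succ (2*l+1), Nat.factorial_succ (2*l), Nat.factorial_succ l]
    simp only [smul_eq_mul]
    push_cast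
    ring

lemma B_s_pow (n a : ℕ) (y : Fin N → ℝ) (p q : MP N) :
    (n.factorial : ℝ) * B (n+a) (s y ^ a * p) q = (n+a).factorial * B n p ((D y)^[a] q) := by
  induction a generalizing q with
  | zero => simp
  | succ a ih =>
    rw [pow_succ', mul_assoc, ← add_assoc, B_s_mul, Function.iterate_succ_apply,
      Nat.factorial_succ]
    have := ih (D y q)
    push_cast
    linear_combination ((n:ℝ)+a+1) * this

lemma D_iter {y : Fin N → ℝ} (hy : ∑ i, y i * y i = 1) (a b m : ℕ) :
    (D y)^[a] (s y ^ b * w y ^ m) = (b.descFactorial a : ℝ) • (s y ^ (b-a) * w y ^ m) := by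
  induction a with
  | zero => simp
  | succ a ih =>
    rw [Function.iterate_succ_apply', ih, Derivation.map_smul, Derivation.leibniz, D_w_pow hy,
      Derivation.leibniz_pow, D_s hy, Nat.descFactorial_succ, Nat.sub_sub]
    simp only [smul_eq_mul, smul_zero, zero_add, nsmul_eq_mul, mul_one, smul_eq_C_mul]
    push_cast
    simp
    ring

lemma B_diag {y : Fin N → ℝ} (hy : ∑ i, y i * y i = 1) (a l : ℕ) :
    B (2*l+a) (s y ^ a * w y ^ l) (s y ^ a * w y ^ l) =
      (2*l+a).factorial * (a.factorial * (4^l * l.factorial * ffac (((N:ℝ)-3)/2 + l) l)) := by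
  have h := B_s_pow (2*l) a y (w y ^ l) (s y ^ a * w y ^ l)
  rw [D_iter hy, Nat.descFactorial_self, Nat.sub_self, pow_zero, one_mul, map_smul,
    B_w_w hy] at h
  have h0 : ((2*l).factorial : ℝ) ≠ 0 := by positivity
  apply mul_left_cancel₀ h0
  rw [h]; simp only [smul_eq_mul]; ring

lemma B_offdiag' {y : Fin N → ℝ} (hy : ∑ i, y i * y i = 1) (k n a b l m : ℕ) (hk : k = n + a)
    (hab : b < a) : B k (s y ^ a * w y ^ l) (s y ^ b * w y ^ m) = 0 := by
  have h := B_s_pow n a y (w y ^ l) (s y ^ b * w y ^ m)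
  rw [D_iter hy, Nat.descFactorial_of_lt hab] at h
  subst hk
  have h0 : (n.factorial : ℝ) ≠ 0 := by positivity
  simpa [h0] using h

lemma B_offdiag {y : Fin N → ℝ} (hy : ∑ i, y i * y i = 1) (k l m : ℕ) (hl : 2*l ≤ k)
    (hm : 2*m ≤ k) (hlm : l ≠ m) :
    B k (s y ^ (k-2*l) * w y ^ l) (s y ^ (k-2*m) * w y ^ m) = 0 := by
  rcases lt_or_gt_of_ne hlm with h | h
  · exact B_offdiag' hy k (2*l) _ _ _ _ (by omega) (by omega)
  · rw [B_symm]; exact B_offdiag' hy k (2*m) _ _ _ _ (by omega) (by omega)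

lemma B_sum {y : Fin N → ℝ} (hy : ∑ i, y i * y i = 1) (k : ℕ) (c : ℕ → ℝ) (P : MP N)
    (hP : P = ∑ l ∈ Finset.range (k/2+1), c l • (s y ^ (k-2*l) * w y ^ l)) :
    B k P P = k.factorial * ∑ l ∈ Finset.range (k/2+1),
      ((k-2*l).factorial * l.factorial * ffac (((N:ℝ)-3)/2 + l) l * (2^l * c l)^2) := by
  subst hP
  simp only [map_sum, LinearMap.sum_apply, map_smul, LinearMap.smul_apply]
  rw [Finset.mul_sum]
  refine Finset.sum_congr rfl fun l hl => ?_
  have hl' : 2*l ≤ k := by have := Finset.mem_range.mp hl; omega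
  rw [Finset.sum_eq_single l]
  · have := B_diag hy (k-2*l) l
    rw [show 2*l+(k-2*l) = k by omega] at this
    rw [this]
    simp only [smul_eq_mul]
    have : (4:ℝ)^l = (2^l)^2 := by rw [← pow_mul, mul_comm, pow_mul]; norm_num
    rw [this]; ring
  · intro m hm hml
    have hm' : 2*m ≤ k := by have := Finset.mem_range.mp hm; omega
    rw [B_offdiag hy k _ _ (by omega) (by omega) (by omega)]
    simp
  · intro h; exact absurd hl h


abbrev E (N : ℕ) := EuclideanSpace ℝ (Fin N)

def HP (f : E N → ℝ) (x : E N) (g : Fin N → ℝ) : Prop :=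
  DifferentiableAt ℝ f x ∧ ∀ i, fderiv ℝ f x (EuclideanSpace.single i 1) = g i

lemma HP.of {f : E N → ℝ} {x : E N} {g : Fin N → ℝ} {f' : E N →L[ℝ] ℝ} (h : HasFDerivAt f f' x)
    (hg : ∀ i, f' (EuclideanSpace.single i 1) = g i) : HP f x g :=
  ⟨h.differentiableAt, fun i => by rw [h.fderiv, hg]⟩

lemma HP.sum {ι : Type*} (t : Finset ι) {f : ι → E N → ℝ} {x : E N} {g : ι → Fin N → ℝ}
    (h : ∀ a ∈ t, HP (f a) x (g a)) :
    HP (fun x => ∑ a ∈ t, f a x) x (fun i => ∑ a ∈ t, g a i) := by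
  refine HP.of (HasFDerivAt.fun_sum fun a ha => (h a ha).1.hasFDerivAt) fun i => ?_
  rw [ContinuousLinearMap.sum_apply]
  exact Finset.sum_congr rfl fun a ha => (h a ha).2 i

lemma HP.mul {f f2 : E N → ℝ} {x : E N} {g g2 : Fin N → ℝ} (h : HP f x g) (h2 : HP f2 x g2) :
    HP (fun x => f x * f2 x) x (fun i => f x * g2 i + f2 x * g i) := by
  refine HP.of (h.1.hasFDerivAt.mul h2.1.hasFDerivAt) fun i => ?_
  simp [h.2, h2.2]

lemma HP.const (c : ℝ) (x : E N) : HP (fun _ => c) x (fun _ => 0) :=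
  HP.of (hasFDerivAt_const c x) fun i => by simp

lemma HP.coord (m : Fin N) (x : E N) : HP (fun x => x m) x (fun i => if m = i then 1 else 0) :=
  HP.of (EuclideanSpace.proj (𝕜 := ℝ) m).hasFDerivAt fun i => by
    simp [Pi.single_apply]

lemma HP.congr {f : E N → ℝ} {x : E N} {g g2 : Fin N → ℝ} (h : HP f x g) (hg : ∀ i, g i = g2 i) :
    HP f x g2 := ⟨h.1, fun i => by rw [h.2, hg]⟩

lemma HP.normSq (x : E N) : HP (fun x => ‖x‖^2) x (fun i => 2 * x i) := by
  refine HP.of (hasStrictFDerivAt_norm_sq x).hasFDerivAt fun i => ?_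
  simp [EuclideanSpace.inner_single_right]

lemma HP.rpow (n : ℕ) {x : E N} (hx : x ≠ 0) :
    HP (fun x => ((‖x‖^2)⁻¹)^n) x (fun i => -(2 * n * x i * ((‖x‖^2)⁻¹)^(n+1))) := by
  have h0 : ‖x‖^2 ≠ 0 := by simpa using hx
  have h := HP.normSq x
  have h1 := ((hasDerivAt_inv h0).pow n).comp_hasFDerivAt x h.1.hasFDerivAt
  refine HP.of h1 fun i => ?_
  simp only [smul_apply, h.2 i, smul_eq_mul]
  cases n with
  | zero => simp
  | succ n =>
    simp only [Nat.add_sub_cancel, ← inv_pow]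
    ring

lemma HP.logn {x : E N} (hx : x ≠ 0) :
    HP (fun x => Real.log ‖x‖) x (fun i => x i * (‖x‖^2)⁻¹) := by
  have h0 : ‖x‖^2 ≠ 0 := by simpa using hx
  have h := HP.normSq x
  have h1 := (h.1.hasFDerivAt.log h0).const_mul (1/2)
  have e : (fun x : E N => Real.log ‖x‖) = fun x => 1/2 * Real.log (‖x‖^2) := by
    funext x; rw [Real.log_pow]; push_cast; ring
  rw [e]
  refine HP.of h1 fun i => ?_
  simp only [smul_apply, h.2 i, smul_eq_mul]
  ring

noncomputable def se (x : E N) : MP N := s (fun i => x i)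

lemma HP.phi_s (φ : MP N →ₗ[ℝ] ℝ) (a : ℕ) (p : MP N) (x : E N) :
    HP (fun x => φ (se x ^ a * p)) x (fun i => a * φ (X i * (se x ^ (a-1) * p))) := by
  induction a generalizing p with
  | zero => simpa using HP.const (φ p) x
  | succ a ih =>
    have e : ∀ x : E N, ∀ p, ∑ m, x m * φ (X m * p) = φ (se x * p) := by
      intro x p
      simp only [se, s, Finset.sum_mul, map_sum, C_mul', smul_mul_assoc, map_smul, smul_eq_mul]
    have h := HP.sum Finset.univ fun m _ => (HP.coord m x).mul (ih (X m * p))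
    have e2 : (fun x : E N => ∑ m, x m * φ (se x ^ a * (X m * p)))
        = fun x => φ (se x ^ (a+1) * p) := by
      funext x
      rw [pow_succ', mul_assoc, ← e]
      refine Finset.sum_congr rfl fun m _ => ?_
      congr 2; ring
    rw [e2] at h
    refine h.congr fun i => ?_
    rw [Finset.sum_add_distrib]
    have e3 : ∑ m, x m * (a * φ (X i * (se x ^ (a-1) * (X m * p)))) =
        a * φ (se x * (X i * (se x ^ (a-1) * p))) := by
      rw [← e, Finset.mul_sum]
      refine Finset.sum_congr rfl fun m _ => ?_
      rw [show X i * (se x ^ (a-1) * (X m * p)) = X m * (X i * (se x ^ (a-1) * p)) by ring]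
      ring
    rw [e3]
    simp only [mul_ite, mul_one, mul_zero, Finset.sum_ite_eq', Finset.mem_univ, if_true]
    rw [show se x ^ a * (X i * p) = X i * (se x ^ a * p) by ring, Nat.add_sub_cancel]
    cases a with
    | zero => simp
    | succ a =>
      rw [Nat.add_sub_cancel, show se x * (X i * (se x ^ a * p)) = X i * (se x ^ (a+1) * p) by ring]
      push_cast; ring

noncomputable def ga (k j : ℕ) : ℝ :=
  -((-1)^(k-j) / (2 * (k-j : ℕ))) * 2^(k-2*j) * (k-j).choose j

lemma ga_zero {k j : ℕ} (h : k < 2*j) : ga k j = 0 := by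
  rw [ga, Nat.choose_eq_zero_of_lt (by omega)]; simp

noncomputable def PP (k : ℕ) (x : E N) : MP N :=
  ∑ j ∈ Finset.range (k+1), (ga k j * ((‖x‖^2)⁻¹)^(k-j)) • (se x ^ (k-2*j) * qq ^ j)

lemma ga1 (k j : ℕ) : ga k j * (k-2*j : ℕ) = 2 * (j+1) * ga (k+1) (j+1) := by
  rcases lt_or_ge (2*j) k with h | h
  · obtain ⟨d, rfl⟩ := Nat.exists_eq_add_of_lt h
    have h1 := Nat.choose_succ_right_eq (j+d+1) j
    rw [show j+d+1-j = d+1 by omega] at h1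
    have h2 : ((j+d+1).choose (j+1) : ℝ) * (j+1) = (j+d+1).choose j * (d+1) := by exact_mod_cast h1
    simp only [ga]
    rw [show 2*j+d+1-j = j+d+1 by omega, show 2*j+d+1+1-(j+1) = j+d+1 by omega,
      show 2*j+d+1-2*j = d+1 by omega, show 2*j+d+1+1-2*(j+1) = d by omega]
    push_cast
    rw [pow_succ (2:ℝ) d]
    linear_combination (2 * ((-1)^(j+d+1) / (2 * ((j:ℝ)+d+1))) * 2^d) * h2
  · rw [ga_zero (show k+1 < 2*(j+1) by omega), show k-2*j = 0 by omega]; simp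

lemma ga2 (k j : ℕ) (hk : 0 < k) :
    -(2 * (k-j : ℕ)) * ga k j = (k+1-2*j : ℕ) * ga (k+1) j := by
  rcases le_or_gt (2*j) k with h | h
  · obtain ⟨d, rfl⟩ := Nat.exists_eq_add_of_le h
    have h1 := Nat.choose_mul_succ_eq (j+d) j
    rw [show j+d+1-j = d+1 by omega] at h1
    have h2 : ((j+d).choose j : ℝ) * (j+d+1) = (j+d+1).choose j * (d+1) := by exact_mod_cast h1
    simp only [ga]
    rw [show 2*j+d-j = j+d by omega, show 2*j+d+1-j = j+d+1 by omega,
      show 2*j+d-2*j = d by omega, show 2*j+d+1-2*j = d+1 by omega]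
    have h3 : ((j:ℝ)+d) ≠ 0 := by
      have : 0 < j + d := by omega
      have : (0:ℝ) < (j+d : ℕ) := by exact_mod_cast this
      push_cast at this; exact this.ne'
    have h4 : ((j:ℝ)+d+1) ≠ 0 := by positivity
    push_cast
    rw [pow_succ (2:ℝ) d, pow_succ (-1:ℝ)]
    field_simp
    linear_combination h2
  · rw [ga_zero h]
    rcases lt_or_ge (k+1) (2*j) with h' | h'
    · rw [ga_zero h']; simp
    · rw [show k+1-2*j = 0 by omega]; simp

lemma pderiv_term (x : E N) (i : Fin N) (a j : ℕ) :
    pderiv i (se x ^ a * qq ^ j) = ((a : ℝ) * x i) • (se x ^ (a-1) * qq ^ j)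
      + (2 * (j:ℝ)) • (X i * (se x ^ a * qq ^ (j-1))) := by
  rw [Derivation.leibniz, Derivation.leibniz_pow, Derivation.leibniz_pow, pderiv_qq, se, pderiv_s]
  have c2 : (C 2 : MP N) = 2 := by exact_mod_cast map_natCast (C : ℝ →+* MP N) 2
  simp only [smul_eq_mul, nsmul_eq_mul, smul_eq_C_mul, C_mul, map_natCast, c2]
  ring

lemma PP_deriv (φ : MP N →ₗ[ℝ] ℝ) (k : ℕ) (hk : 0 < k) {x : E N} (hx : x ≠ 0) :
    HP (fun x => φ (PP k x)) x (fun i => φ (pderiv i (PP (k+1) x))) := by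
  have h := HP.sum (Finset.range (k+1)) fun j _ =>
    ((HP.const (ga k j) x).mul (HP.rpow (k-j) hx)).mul (HP.phi_s φ (k-2*j) (qq^j) x)
  have e : (fun x : E N => φ (PP k x)) = fun x => ∑ j ∈ Finset.range (k+1),
      ga k j * ((‖x‖^2)⁻¹)^(k-j) * φ (se x ^ (k-2*j) * qq ^ j) := by
    funext x; simp [PP]
  rw [e]
  refine h.congr fun i => ?_
  simp only [PP, map_sum, Derivation.map_smul, pderiv_term, map_smul, map_add, smul_eq_mul]
  simp only [mul_zero, add_zero, mul_add]
  rw [Finset.sum_add_distrib, Finset.sum_add_distrib, add_comm]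
  refine congrArg₂ (· + ·) ?_ ?_
  · conv_rhs => rw [Finset.sum_range_succ, ga_zero (show k+1 < 2*(k+1) by omega)]
    simp only [zero_mul, add_zero]
    refine Finset.sum_congr rfl fun j hj => ?_
    have hj' := Finset.mem_range.mp hj
    have h2 := ga2 k j hk
    rw [show k+1-j = k-j+1 by omega]
    rcases le_or_gt (2*j) k with h | h
    · rw [show k+1-2*j-1 = k-2*j by omega]
      linear_combination ((‖x‖^2)⁻¹)^(k-j+1) * x i * φ (se x ^ (k-2*j) * qq ^ j) * h2
    · rw [ga_zero h]
      have h3 : ((k+1-2*j : ℕ):ℝ) = 0 := by rw [show k+1-2*j = 0 by omega]; simp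
      rw [h3]; simp
  · conv_rhs => rw [Finset.sum_range_succ']
    simp only [Nat.cast_zero, mul_zero, zero_mul, add_zero]
    refine Finset.sum_congr rfl fun j hj => ?_
    have h1 := ga1 k j
    rw [show k+1-(j+1) = k-j by omega, show k+1-2*(j+1) = k-2*j-1 by omega, Nat.add_sub_cancel]
    push_cast
    linear_combination ((‖x‖^2)⁻¹)^(k-j) * φ (X i * (se x ^ (k-2*j-1) * qq ^ j)) * h1

lemma pdIter_eq (l : List (Fin N)) (i : Fin N) {x : E N} (hx : x ≠ 0) :
    pdIter (i :: l) (fun y => Real.log ‖y‖) x = phi (i :: l) (PP (l.length+1) x) := by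
  induction l generalizing i x with
  | nil =>
    have h := (HP.logn hx).2 i
    simp only [pdIter, List.foldr, pd]
    rw [h]
    simp [PP, phi, Finset.sum_range_succ, ga, se, pderiv_s, cc]
    ring
  | cons j l ih =>
    have h := PP_deriv (phi (j :: l)) (l.length+1) (by omega) hx
    have h2 := h.2 i
    change fderiv ℝ (pdIter (j :: l) (fun y => Real.log ‖y‖)) x _ = _
    have e : pdIter (j :: l) (fun y => Real.log ‖y‖) =ᶠ[nhds x]
        fun x => phi (j :: l) (PP (l.length+1) x) := by
      filter_upwards [isOpen_ne.mem_nhds hx] with z hz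
      exact ih j hz
    rw [e.fderiv_eq, h2]
    rfl

lemma gradSq_eq (k : ℕ) (hk : 0 < k) {x : E N} (hx : x ≠ 0) :
    gradSq N k (fun y => Real.log ‖y‖) x = B k (PP k x) (PP k x) := by
  obtain ⟨k, rfl⟩ : ∃ m, k = m+1 := ⟨k-1, by omega⟩
  rw [gradSq, B_eq_sum]
  refine Finset.sum_congr rfl fun i _ => ?_
  rw [List.ofFn_succ, pdIter_eq _ _ hx, List.length_ofFn, sq]

lemma PP_expand (k : ℕ) {x : E N} (hx : x ≠ 0) :
    (‖x‖^k) • PP k x = ∑ l ∈ Finset.range (k/2+1),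
      (∑ j ∈ Finset.range (k/2+1), ga k j * j.choose l) •
        (s (fun i => ‖x‖⁻¹ * x i) ^ (k-2*l) * w (fun i => ‖x‖⁻¹ * x i) ^ l) := by
  have h0 : ‖x‖ ≠ 0 := by simpa using hx
  set y : Fin N → ℝ := fun i => ‖x‖⁻¹ * x i with hy
  have hs : se x = C ‖x‖ * s y := by
    simp only [se, s, Finset.mul_sum, ← mul_assoc, ← C_mul, hy]
    refine Finset.sum_congr rfl fun i _ => ?_
    rw [mul_inv_cancel₀ h0, one_mul]
  have hq : (qq : MP N) = w y + s y * s y := by simp [w]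
  rw [PP, ← Finset.sum_subset (Finset.range_subset_range.mpr (show k/2+1 ≤ k+1 by omega))]
  · rw [Finset.smul_sum]
    simp only [Finset.sum_smul]
    rw [Finset.sum_comm]
    refine Finset.sum_congr rfl fun j hj => ?_
    have hj' : 2*j ≤ k := by have := Finset.mem_range.mp hj; omega
    have e1 : ‖x‖^k * (((‖x‖^2)⁻¹)^(k-j) * ‖x‖^(k-2*j)) = 1 := by
      obtain ⟨d, rfl⟩ := Nat.exists_eq_add_of_le hj'
      rw [show 2*j+d-j = j+d by omega, show 2*j+d-2*j = d by omega]
      have : (‖x‖*‖x‖⁻¹)^(2*(j+d)) = 1 := by rw [mul_inv_cancel₀ h0, one_pow]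
      rw [← this, ← inv_pow]
      ring
    have e2 : ‖x‖^k • (ga k j * ((‖x‖^2)⁻¹)^(k-j)) • (se x ^ (k-2*j) * qq ^ j)
        = ga k j • (s y ^ (k-2*j) * qq ^ j) := by
      rw [hs, mul_pow, ← C_pow, mul_assoc, ← smul_eq_C_mul, smul_smul, smul_smul]
      congr 1
      linear_combination ga k j * e1
    rw [e2, hq, add_pow, Finset.mul_sum, Finset.smul_sum]
    have hsub : Finset.range (j+1) ⊆ Finset.range (k/2+1) :=
      Finset.range_subset_range.mpr (by omega)
    rw [← Finset.sum_subset hsub]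
    · refine Finset.sum_congr rfl fun l hl => ?_
      have hl' : l ≤ j := by have := Finset.mem_range.mp hl; omega
      have e3 : s y ^ (k-2*l) = s y ^ (k-2*j) * (s y * s y)^(j-l) := by
        rw [← sq, ← pow_mul, ← pow_add]; congr 1; omega
      rw [e3]
      simp only [smul_eq_C_mul, C_mul, map_natCast]
      ring
    · intro l _ hl
      have : j < l := by simpa using hl
      rw [Nat.choose_eq_zero_of_lt this]; simp
  · intro j _ hj
    have : k/2+1 ≤ j := by simpa using hj
    rw [ga_zero (by omega)]; simp

lemma gchoose_nat (n m : ℕ) : gchoose (n:ℝ) m = n.choose m := by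
  have h : ∀ m : ℕ, ffac (n:ℝ) m = n.descFactorial m := by
    intro m
    induction m with
    | zero => simp [ffac]
    | succ m ih =>
      rw [ffac, Finset.prod_range_succ, ← ffac, ih, Nat.descFactorial_succ]
      rcases le_or_gt m n with h | h
      · push_cast [h]; ring
      · rw [Nat.descFactorial_of_lt h]; simp
  rw [gchoose, h, Nat.descFactorial_eq_factorial_mul_choose]
  have : (m.factorial : ℝ) ≠ 0 := by positivity
  push_cast
  field_simp

lemma inner_eq (k l : ℕ) (hk : 0 < k) :
    (∑ n ∈ Finset.Icc ((k + 1) / 2) (k - l),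
              (2 : ℝ) ^ (2 * n - k + l) * ((-1 : ℝ) ^ n / (2 * n)) *
                gchoose (n : ℝ) (k - n) * gchoose ((k - n : ℕ) : ℝ) l) =
      - (2^l * ∑ j ∈ Finset.range (k/2+1), ga k j * j.choose l) := by
  have hsub : Finset.Icc ((k + 1) / 2) (k - l) ⊆ Finset.Icc ((k+1)/2) k :=
    Finset.Icc_subset_Icc_right (by omega)
  rw [Finset.sum_subset hsub]
  · rw [Finset.mul_sum, ← Finset.sum_neg_distrib]
    refine Finset.sum_bij' (fun n _ => k - n) (fun j _ => k - j) ?_ ?_ ?_ ?_ ?_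
    · intro n hn; simp only [Finset.mem_Icc, Finset.mem_range] at *; omega
    · intro n hn; simp only [Finset.mem_Icc, Finset.mem_range] at *; omega
    · intro n hn; simp only [Finset.mem_Icc, Finset.mem_range] at *; omega
    · intro n hn; simp only [Finset.mem_Icc, Finset.mem_range] at *; omega
    · intro n hn
      simp only [Finset.mem_Icc] at hn
      rw [gchoose_nat, gchoose_nat, ga, show k-(k-n) = n by omega, show k-2*(k-n) = 2*n-k by omega,
        pow_add]
      ring
  · intro n hn hn'
    simp only [Finset.mem_Icc] at hn hn'
    rw [gchoose_nat (k-n) l, Nat.choose_eq_zero_of_lt (by omega)]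
    simp

end Aux

theorem stmt_3 (N k : ℕ) (hN : 0 < N) (hk : 0 < k)
    (x : EuclideanSpace ℝ (Fin N)) (hx : x ≠ 0) :
    ‖x‖ ^ (2 * k) * gradSq N k (fun y => Real.log ‖y‖) x =
      (Nat.factorial k : ℝ) *
        ∑ l ∈ Finset.range (k / 2 + 1),
          (Nat.factorial (k - 2 * l) : ℝ) * (Nat.factorial l : ℝ) *
            ffac (((N : ℝ) - 3) / 2 + l) l *
            (∑ n ∈ Finset.Icc ((k + 1) / 2) (k - l),
              (2 : ℝ) ^ (2 * n - k + l) * ((-1 : ℝ) ^ n / (2 * n)) *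
                gchoose (n : ℝ) (k - n) * gchoose ((k - n : ℕ) : ℝ) l) ^ 2 := by
  have h0 : ‖x‖ ≠ 0 := by simpa using hx
  have hy : ∑ i, (‖x‖⁻¹ * x i) * (‖x‖⁻¹ * x i) = 1 := by
    have h1 : ∑ i, x i * x i = ‖x‖^2 := by
      rw [EuclideanSpace.real_norm_sq_eq]
      exact Finset.sum_congr rfl fun i _ => by ring
    have h2 : ∀ i, (‖x‖⁻¹ * x i) * (‖x‖⁻¹ * x i) = (‖x‖⁻¹)^2 * (x i * x i) := fun i => by ring
    simp only [h2, ← Finset.mul_sum, h1]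
    field_simp
  have h := Aux.B_sum hy k _ _ (Aux.PP_expand k hx)
  rw [map_smul, map_smul, LinearMap.smul_apply, ← Aux.gradSq_eq k hk hx] at h
  simp only [smul_eq_mul] at h
  rw [show ‖x‖^(2*k) = ‖x‖^k * ‖x‖^k by ring, mul_assoc, h]
  congr 1
  refine Finset.sum_congr rfl fun l _ => ?_
  rw [Aux.inner_eq k l hk, neg_sq]
end

section
/- Let N be a positive integer and let k be a nonnegative integer. Then for every x ∈ ℝ^N \ {0}, |x|^{2(k+N−2)} · |∇_N^k w(x)|² = 2^k · (N/2 + k − 2)_k · (N + k − 3)_k, where w(x) = |x|^{−(N−2)}. -/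
open scoped BigOperators

open scoped ContDiff

/-- Smoothness away from the origin. -/
def SmP {N : ℕ} (u : EuclideanSpace ℝ (Fin N) → ℝ) : Prop :=
  ∀ x, x ≠ 0 → ContDiffAt ℝ ∞ u x

/-- The Laplacian. -/
noncomputable def lap4 {N : ℕ} (u : EuclideanSpace ℝ (Fin N) → ℝ)
    (x : EuclideanSpace ℝ (Fin N)) : ℝ := ∑ i, pd i (pd i u) x

lemma SmP.diff {N : ℕ} {u : EuclideanSpace ℝ (Fin N) → ℝ} (hu : SmP u)
    {x : EuclideanSpace ℝ (Fin N)} (hx : x ≠ 0) : DifferentiableAt ℝ u x :=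
  (hu x hx).differentiableAt (by simp)

lemma SmP.pd4 {N : ℕ} {u : EuclideanSpace ℝ (Fin N) → ℝ} (hu : SmP u) (i : Fin N) :
    SmP (pd i u) := by
  intro x hx
  have h : ContDiffAt ℝ ∞ (fderiv ℝ u) x := (hu x hx).fderiv_right (m := ∞) (by simp)
  exact h.clm_apply contDiffAt_const

lemma SmP.pdIter4 {N : ℕ} {u : EuclideanSpace ℝ (Fin N) → ℝ} (hu : SmP u) (l : List (Fin N)) :
    SmP (pdIter l u) := by
  induction l with
  | nil => exact hu
  | cons i l ih => exact ih.pd4 i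

lemma pd_congr4 {N : ℕ} {u v : EuclideanSpace ℝ (Fin N) → ℝ} (h : ∀ x, x ≠ 0 → u x = v x)
    (i : Fin N) : ∀ x, x ≠ 0 → pd i u x = pd i v x := by
  intro x hx
  have : u =ᶠ[nhds x] v := by
    filter_upwards [isOpen_ne.mem_nhds hx] with y hy using h y hy
  simp only [pd, this.fderiv_eq]

lemma lap_congr4 {N : ℕ} {u v : EuclideanSpace ℝ (Fin N) → ℝ} (h : ∀ x, x ≠ 0 → u x = v x) :
    ∀ x, x ≠ 0 → lap4 u x = lap4 v x := by
  intro x hx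
  exact Finset.sum_congr rfl fun i _ => pd_congr4 (pd_congr4 h i) i x hx

lemma pd_mul4 {N : ℕ} {u v : EuclideanSpace ℝ (Fin N) → ℝ} (hu : SmP u) (hv : SmP v)
    (i : Fin N) : ∀ x, x ≠ 0 →
    pd i (fun y => u y * v y) x = u x * pd i v x + v x * pd i u x := by
  intro x hx
  simp only [pd]
  rw [fderiv_fun_mul (hu.diff hx) (hv.diff hx)]
  simp

lemma pd_sum4 {N : ℕ} {ι : Type*} (s : Finset ι) {u : ι → EuclideanSpace ℝ (Fin N) → ℝ}
    (hu : ∀ a, SmP (u a)) (i : Fin N) : ∀ x, x ≠ 0 →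
    pd i (fun y => ∑ a ∈ s, u a y) x = ∑ a ∈ s, pd i (u a) x := by
  intro x hx
  simp only [pd]
  rw [fderiv_fun_sum (fun a _ => (hu a).diff hx)]
  simp

lemma pd_comm4 {N : ℕ} {u : EuclideanSpace ℝ (Fin N) → ℝ} (hu : SmP u) (i j : Fin N) :
    ∀ x, x ≠ 0 → pd i (pd j u) x = pd j (pd i u) x := by
  intro x hx
  have hs : IsSymmSndFDerivAt ℝ u x := (hu x hx).isSymmSndFDerivAt (by simp; exact WithTop.coe_le_coe.2 (le_top : (2 : ℕ∞) ≤ ⊤))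
  have hd : DifferentiableAt ℝ (fderiv ℝ u) x :=
    ((hu x hx).fderiv_right (m := ∞) (by simp)).differentiableAt (by simp)
  have key : ∀ i j : Fin N, pd i (pd j u) x = fderiv ℝ (fderiv ℝ u) x
      (EuclideanSpace.single i 1) (EuclideanSpace.single j 1) := by
    intro i j
    unfold pd
    rw [fderiv_clm_apply hd (differentiableAt_const _)]
    simp
  rw [key, key]
  exact hs _ _

lemma lap_pd4 {N : ℕ} {u : EuclideanSpace ℝ (Fin N) → ℝ} (hu : SmP u)
    (h : ∀ x, x ≠ 0 → lap4 u x = 0) (j : Fin N) : ∀ x, x ≠ 0 → lap4 (pd j u) x = 0 := by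
  intro x hx
  have h1 : lap4 (pd j u) x = pd j (lap4 u) x := by
    have := pd_sum4 Finset.univ (u := fun i => pd i (pd i u)) (fun i => (hu.pd4 i).pd4 i) j x hx
    change _ = pd j (fun y => ∑ i, pd i (pd i u) y) x
    rw [this]
    refine Finset.sum_congr rfl fun i _ => ?_
    rw [pd_congr4 (pd_comm4 hu i j) i x hx, pd_comm4 (hu.pd4 i) i j x hx]
  rw [h1, pd_congr4 (v := fun _ => 0) h j x hx]
  simp [pd]

lemma lap_pdIter4 {N : ℕ} {u : EuclideanSpace ℝ (Fin N) → ℝ} (hu : SmP u)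
    (h : ∀ x, x ≠ 0 → lap4 u x = 0) (l : List (Fin N)) :
    ∀ x, x ≠ 0 → lap4 (pdIter l u) x = 0 := by
  induction l with
  | nil => exact h
  | cons i l ih => exact lap_pd4 (hu.pdIter4 l) ih i

lemma SmP.mul {N : ℕ} {u v : EuclideanSpace ℝ (Fin N) → ℝ} (hu : SmP u) (hv : SmP v) :
    SmP (fun y => u y * v y) := fun x hx => (hu x hx).mul (hv x hx)

lemma SmP.add {N : ℕ} {u v : EuclideanSpace ℝ (Fin N) → ℝ} (hu : SmP u) (hv : SmP v) :
    SmP (fun y => u y + v y) := fun x hx => (hu x hx).add (hv x hx)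

lemma pd_add4 {N : ℕ} {u v : EuclideanSpace ℝ (Fin N) → ℝ} (hu : SmP u) (hv : SmP v)
    (i : Fin N) : ∀ x, x ≠ 0 →
    pd i (fun y => u y + v y) x = pd i u x + pd i v x := by
  intro x hx
  simp only [pd]
  rw [fderiv_fun_add (hu.diff hx) (hv.diff hx)]
  simp

lemma lap_sq4 {N : ℕ} {u : EuclideanSpace ℝ (Fin N) → ℝ} (hu : SmP u)
    (h : ∀ x, x ≠ 0 → lap4 u x = 0) : ∀ x, x ≠ 0 →
    lap4 (fun y => u y ^ 2) x = 2 * ∑ j, (pd j u x) ^ 2 := by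
  intro x hx
  have e : ∀ j, pd j (pd j (fun y => u y ^ 2)) x
      = 2 * (pd j u x) ^ 2 + 2 * u x * pd j (pd j u) x := by
    intro j
    have h1 : ∀ y, y ≠ 0 → pd j (fun y => u y ^ 2) y = u y * pd j u y + u y * pd j u y := by
      intro y hy
      simp only [pow_two]
      exact pd_mul4 hu hu j y hy
    rw [pd_congr4 h1 j x hx, pd_add4 (hu.mul (hu.pd4 j)) (hu.mul (hu.pd4 j)) j x hx,
      pd_mul4 hu (hu.pd4 j) j x hx]
    ring
  unfold lap4
  simp only [e]
  rw [Finset.sum_add_distrib, ← Finset.mul_sum, ← Finset.mul_sum]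
  have := h x hx
  unfold lap4 at this
  rw [this]; ring

lemma lap_sum4 {N : ℕ} {ι : Type*} (s : Finset ι) {u : ι → EuclideanSpace ℝ (Fin N) → ℝ}
    (hu : ∀ a, SmP (u a)) : ∀ x, x ≠ 0 →
    lap4 (fun y => ∑ a ∈ s, u a y) x = ∑ a ∈ s, lap4 (u a) x := by
  intro x hx
  unfold lap4
  rw [Finset.sum_comm]
  refine Finset.sum_congr rfl fun i _ => ?_
  rw [pd_congr4 (pd_sum4 s hu i) i x hx, pd_sum4 s (fun a => (hu a).pd4 i) i x hx]

lemma lap_gradSq4 {N : ℕ} {u : EuclideanSpace ℝ (Fin N) → ℝ} (hu : SmP u)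
    (h : ∀ x, x ≠ 0 → lap4 u x = 0) (k : ℕ) : ∀ x, x ≠ 0 →
    lap4 (gradSq N k u) x = 2 * gradSq N (k + 1) u x := by
  intro x hx
  have h1 := lap_sum4 (Finset.univ : Finset (Fin k → Fin N))
    (u := fun i y => (pdIter (List.ofFn i) u y) ^ 2)
    (fun i y hy => (hu.pdIter4 _ y hy).pow 2) x hx
  change lap4 (fun y => ∑ i : Fin k → Fin N, (pdIter (List.ofFn i) u y) ^ 2) x = _
  rw [h1]
  simp only [fun i : Fin k → Fin N =>
    lap_sq4 (hu.pdIter4 (List.ofFn i)) (lap_pdIter4 hu h (List.ofFn i)) x hx]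
  rw [← Finset.mul_sum]
  congr 1
  unfold gradSq
  rw [← (Fin.consEquiv (fun _ : Fin (k + 1) => Fin N)).sum_comp, Fintype.sum_prod_type,
    Finset.sum_comm]
  refine Finset.sum_congr rfl fun j _ => Finset.sum_congr rfl fun i _ => ?_
  simp [Fin.consEquiv, List.ofFn_succ, pdIter]

lemma SmP.norm_rpow {N : ℕ} (a : ℝ) : SmP (fun y : EuclideanSpace ℝ (Fin N) => ‖y‖ ^ a) :=
  fun x hx => (contDiffAt_norm ℝ hx).rpow_const_of_ne (norm_ne_zero_iff.2 hx)

lemma pd_norm4 {N : ℕ} (a : ℝ) (i : Fin N) : ∀ x : EuclideanSpace ℝ (Fin N), x ≠ 0 →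
    pd i (fun y => ‖y‖ ^ a) x = a * (x i * ‖x‖ ^ (a - 2)) := by
  intro x hx
  have hn : 0 < ‖x‖ := norm_pos_iff.2 hx
  have h1 : HasFDerivAt (fun y : EuclideanSpace ℝ (Fin N) => ‖y‖ ^ 2) (2 • innerSL ℝ x) x :=
    (hasStrictFDerivAt_norm_sq x).hasFDerivAt
  have h2 := h1.rpow_const (p := a / 2) (Or.inl (by positivity))
  have e : (fun y : EuclideanSpace ℝ (Fin N) => (‖y‖ ^ 2) ^ (a / 2)) = fun y => ‖y‖ ^ a := by
    funext y
    rw [← Real.rpow_natCast, ← Real.rpow_mul (norm_nonneg y)]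
    congr 1; push_cast; ring
  have e2 : (‖x‖ ^ 2) ^ (a / 2 - 1) = ‖x‖ ^ (a - 2) := by
    rw [← Real.rpow_natCast, ← Real.rpow_mul (norm_nonneg x)]
    congr 1; push_cast; ring
  rw [e, e2] at h2
  simp only [pd, h2.fderiv]
  simp [EuclideanSpace.inner_single_right]
  ring

lemma SmP.coord {N : ℕ} (i : Fin N) : SmP (fun y : EuclideanSpace ℝ (Fin N) => y i) :=
  fun x _ => (EuclideanSpace.proj (𝕜 := ℝ) i).contDiff.contDiffAt

lemma pd_coord4 {N : ℕ} (i : Fin N) (x : EuclideanSpace ℝ (Fin N)) :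
    pd i (fun y => y i) x = 1 := by
  have : HasFDerivAt (fun y : EuclideanSpace ℝ (Fin N) => y i) (EuclideanSpace.proj (𝕜 := ℝ) i) x :=
    (EuclideanSpace.proj (𝕜 := ℝ) i).hasFDerivAt
  simp [pd, this.fderiv]

lemma pd_smul4 {N : ℕ} (c : ℝ) {u : EuclideanSpace ℝ (Fin N) → ℝ} (hu : SmP u)
    (i : Fin N) : ∀ x, x ≠ 0 → pd i (fun y => c * u y) x = c * pd i u x := by
  intro x hx
  simp only [pd]
  rw [fderiv_const_mul (hu.diff hx)]
  simp

lemma lap_norm4 {N : ℕ} (a : ℝ) : ∀ x : EuclideanSpace ℝ (Fin N), x ≠ 0 →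
    lap4 (fun y => ‖y‖ ^ a) x = a * (a + N - 2) * ‖x‖ ^ (a - 2) := by
  intro x hx
  have hn : 0 < ‖x‖ := norm_pos_iff.2 hx
  have e : ∀ i, pd i (pd i (fun y : EuclideanSpace ℝ (Fin N) => ‖y‖ ^ a)) x
      = a * (a - 2) * ‖x‖ ^ (a - 2 - 2) * (x i) ^ 2 + a * ‖x‖ ^ (a - 2) := by
    intro i
    rw [pd_congr4 (pd_norm4 a i) i x hx,
      pd_smul4 a ((SmP.coord i).mul (SmP.norm_rpow (a - 2))) i x hx,
      pd_mul4 (SmP.coord i) (SmP.norm_rpow (a - 2)) i x hx, pd_coord4, pd_norm4 _ i x hx]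
    ring
  unfold lap4
  simp only [e]
  rw [Finset.sum_add_distrib, ← Finset.mul_sum]
  have hs : ∑ i, (x i) ^ 2 = ‖x‖ ^ 2 := (EuclideanSpace.real_norm_sq_eq x).symm
  have hp : ‖x‖ ^ (a - 2) = ‖x‖ ^ (a - 2 - 2) * ‖x‖ ^ 2 := by
    rw [← Real.rpow_natCast ‖x‖ 2, ← Real.rpow_add hn]
    congr 1; push_cast; ring
  rw [hs, Finset.sum_const, hp]
  simp
  ring

lemma lap_smul4 {N : ℕ} (c : ℝ) {u : EuclideanSpace ℝ (Fin N) → ℝ} (hu : SmP u) :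
    ∀ x, x ≠ 0 → lap4 (fun y => c * u y) x = c * lap4 u x := by
  intro x hx
  unfold lap4
  rw [Finset.mul_sum]
  refine Finset.sum_congr rfl fun i _ => ?_
  rw [pd_congr4 (pd_smul4 c hu i) i x hx, pd_smul4 c (hu.pd4 i) i x hx]

lemma ffac_succ4 (ν : ℝ) (k : ℕ) : ffac (ν + 1) (k + 1) = (ν + 1) * ffac ν k := by
  unfold ffac
  rw [Finset.prod_range_succ', mul_comm]
  congr 1
  · simp
  · refine Finset.prod_congr rfl fun j _ => ?_
    push_cast; ring

lemma gradSq_w4 (N : ℕ) (k : ℕ) : ∀ x : EuclideanSpace ℝ (Fin N), x ≠ 0 →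
    gradSq N k (fun y => ‖y‖ ^ (-((N : ℝ) - 2))) x =
      (2 ^ k * ffac ((N : ℝ) / 2 + k - 2) k * ffac ((N : ℝ) + k - 3) k) *
        ‖x‖ ^ (-(2 * ((k : ℝ) + N - 2))) := by
  induction k with
  | zero =>
    intro x hx
    simp only [gradSq, pdIter, ffac]
    simp
    rw [← Real.rpow_natCast, ← Real.rpow_mul (norm_nonneg x)]
    congr 1; push_cast; ring
  | succ k ih =>
    intro x hx
    have hh : ∀ x : EuclideanSpace ℝ (Fin N), x ≠ 0 →
        lap4 (fun y => ‖y‖ ^ (-((N : ℝ) - 2))) x = 0 := by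
      intro x hx
      rw [lap_norm4 _ x hx]; ring
    have h1 := lap_gradSq4 (SmP.norm_rpow (N := N) (-((N : ℝ) - 2))) hh k x hx
    rw [lap_congr4 ih x hx, lap_smul4 _ (SmP.norm_rpow _) x hx, lap_norm4 _ x hx] at h1
    have a1 : (N : ℝ) / 2 + ((k + 1 : ℕ) : ℝ) - 2 = ((N : ℝ) / 2 + k - 2) + 1 := by
      push_cast; ring
    have a2 : (N : ℝ) + ((k + 1 : ℕ) : ℝ) - 3 = ((N : ℝ) + k - 3) + 1 := by
      push_cast; ring
    have a3 : -(2 * (((k + 1 : ℕ) : ℝ) + N - 2)) = -(2 * ((k : ℝ) + N - 2)) - 2 := by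
      push_cast; ring
    rw [a1, a2, a3, ffac_succ4, ffac_succ4, pow_succ]
    linear_combination (-1 / 2) * h1

theorem stmt_4 (N : ℕ) (hN : 0 < N) (k : ℕ)
    (x : EuclideanSpace ℝ (Fin N)) (hx : x ≠ 0) :
    ‖x‖ ^ (2 * ((k : ℝ) + N - 2)) *
        gradSq N k (fun y => ‖y‖ ^ (-((N : ℝ) - 2))) x =
      2 ^ k * ffac ((N : ℝ) / 2 + k - 2) k * ffac ((N : ℝ) + k - 3) k := by
  have hn : 0 < ‖x‖ := norm_pos_iff.2 hx
  rw [gradSq_w4 N k x hx, mul_left_comm, ← Real.rpow_add hn]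
  simp
end

section
/- Let k be a positive integer. Then for every x ∈ ℝ² \ {0}, |x|^{2k} · |∇_2^k v(x)|² = 2^{k−1} · ((k−1)!)², where v(x) = log|x|. -/
open scoped BigOperators

/-- The complex number `x₀ + i x₁`, as a continuous linear map. -/
noncomputable def zc : EuclideanSpace ℝ (Fin 2) →L[ℝ] ℂ :=
  (EuclideanSpace.proj (0 : Fin 2) : EuclideanSpace ℝ (Fin 2) →L[ℝ] ℝ).smulRight (1 : ℂ) +
  (EuclideanSpace.proj (1 : Fin 2) : EuclideanSpace ℝ (Fin 2) →L[ℝ] ℝ).smulRight Complex.I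

/-- The directions `1` and `i`. -/
noncomputable def ec (i : Fin 2) : ℂ := zc (EuclideanSpace.single i 1)

lemma ec_zero : ec 0 = 1 := by simp [ec, zc]
lemma ec_one : ec 1 = Complex.I := by simp [ec, zc]

lemma zc_normSq (x : EuclideanSpace ℝ (Fin 2)) : Complex.normSq (zc x) = ‖x‖ ^ 2 := by
  rw [EuclideanSpace.norm_sq_eq, Complex.normSq_apply]
  simp [zc, Fin.sum_univ_two]
  ring

lemma zc_ne {x : EuclideanSpace ℝ (Fin 2)} (hx : x ≠ 0) : zc x ≠ 0 := by
  rw [← Complex.normSq_pos, zc_normSq]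
  positivity

lemma pd_log (i : Fin 2) (x : EuclideanSpace ℝ (Fin 2)) (hx : x ≠ 0) :
    pd i (fun y => Real.log ‖y‖) x = (ec i * (zc x)⁻¹).re := by
  have h1 : (fun y : EuclideanSpace ℝ (Fin 2) => Real.log ‖y‖)
      = fun y => (1 / 2 : ℝ) * Real.log (‖y‖ ^ 2) := by
    funext y
    rw [Real.log_pow]; push_cast; ring
  have hn : ‖x‖ ^ 2 ≠ 0 := by positivity
  have h2 := (((hasStrictFDerivAt_norm_sq x).hasFDerivAt.log hn).const_mul (1 / 2 : ℝ)).fderiv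
  rw [pd, h1, h2]
  rw [Complex.mul_re, Complex.inv_re, Complex.inv_im, zc_normSq]
  fin_cases i
  · simp [ec_zero, zc, EuclideanSpace.inner_single_right]; field_simp
  · simp [ec_one, zc, EuclideanSpace.inner_single_right]; field_simp

lemma pd_pow (i : Fin 2) (c : ℂ) (n : ℕ) (x : EuclideanSpace ℝ (Fin 2)) (hx : x ≠ 0) :
    pd i (fun y => (c * ((zc y)⁻¹) ^ (n + 1)).re) x =
      (ec i * c * (-(n + 1 : ℂ)) * ((zc x)⁻¹) ^ (n + 2)).re := by
  have hz := zc_ne hx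
  have h1 : HasDerivAt (fun z : ℂ => c * (z⁻¹) ^ (n + 1))
      (c * (((n + 1 : ℕ) : ℂ) * ((zc x)⁻¹) ^ n * (-((zc x) ^ 2)⁻¹))) (zc x) := by
    simpa using ((hasDerivAt_inv hz).pow (n + 1)).const_mul c
  have h2 := (h1.hasFDerivAt.restrictScalars ℝ).comp x zc.hasFDerivAt
  have h3 := (Complex.reCLM.hasFDerivAt.comp x h2).fderiv
  have h4 : (fun y => (c * ((zc y)⁻¹) ^ (n + 1)).re)
    = (⇑Complex.reCLM ∘ (fun z : ℂ => c * (z⁻¹) ^ (n + 1)) ∘ ⇑zc) := rfl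
  rw [pd, h4, h3]
  simp only [ContinuousLinearMap.comp_apply, Complex.reCLM_apply]
  congr 1
  change zc (EuclideanSpace.single i 1) • (_ : ℂ) = _
  rw [smul_eq_mul, ← ec, ← inv_pow]
  push_cast
  ring

lemma pdIter_log (l : List (Fin 2)) : ∀ (i : Fin 2) (x : EuclideanSpace ℝ (Fin 2)), x ≠ 0 →
    pdIter (i :: l) (fun y => Real.log ‖y‖) x =
      (((i :: l).map ec).prod * ((-1) ^ l.length * (Nat.factorial l.length : ℂ))
        * ((zc x)⁻¹) ^ (l.length + 1)).re := by
  induction l with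
  | nil => intro i x hx; simpa [pdIter] using pd_log i x hx
  | cons j l ih =>
    intro i x hx
    have he : pdIter (j :: l) (fun y => Real.log ‖y‖) =ᶠ[nhds x] _ :=
      Filter.eventuallyEq_of_mem (isOpen_ne.mem_nhds hx) (fun y hy => ih j y hy)
    have : pdIter (i :: j :: l) (fun y => Real.log ‖y‖) x
      = pd i (pdIter (j :: l) (fun y => Real.log ‖y‖)) x := rfl
    rw [this, pd, he.fderiv_eq, ← pd, pd_pow i _ _ x hx]
    congr 1
    simp only [List.map_cons, List.prod_cons, List.length_cons, Nat.factorial_succ]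
    push_cast
    ring

lemma sum_re (k : ℕ) : ∀ w : ℂ,
    ∑ i : Fin (k + 1) → Fin 2, ((((List.ofFn i).map ec).prod * w).re) ^ 2
      = 2 ^ k * Complex.normSq w := by
  have key : ∀ (k : ℕ) (w : ℂ),
    ∑ i : Fin (k + 1) → Fin 2, ((((List.ofFn i).map ec).prod * w).re) ^ 2
      = ∑ j : Fin 2, ∑ i : Fin k → Fin 2, ((((List.ofFn i).map ec).prod * (ec j * w)).re) ^ 2 := by
    intro k w
    rw [← (Fin.consEquiv (fun _ : Fin (k + 1) => Fin 2)).sum_comp, Fintype.sum_prod_type]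
    refine Finset.sum_congr rfl fun j _ => Finset.sum_congr rfl fun i _ => ?_
    change ((((List.ofFn (Fin.cons j i : Fin (k + 1) → Fin 2)).map ec).prod * w).re) ^ 2 = _
    simp only [List.ofFn_succ, Fin.cons_zero, Fin.cons_succ, List.map_cons, List.prod_cons]
    congr 2
    ring
  induction k with
  | zero =>
    intro w
    rw [key]
    simp [Fin.sum_univ_two, ec_zero, ec_one, Complex.normSq_apply]
    ring
  | succ k ih =>
    intro w
    rw [key]
    simp only [ih, Fin.sum_univ_two, ec_zero, ec_one, map_mul, Complex.normSq_I, map_one]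
    ring

theorem stmt_5 (k : ℕ) (hk : 0 < k) (x : EuclideanSpace ℝ (Fin 2)) (hx : x ≠ 0) :
    ‖x‖ ^ (2 * k) * gradSq 2 k (fun y => Real.log ‖y‖) x =
      2 ^ (k - 1) * (Nat.factorial (k - 1) : ℝ) ^ 2 := by
  obtain ⟨m, rfl⟩ : ∃ m, k = m + 1 := ⟨k - 1, by omega⟩
  have h : gradSq 2 (m + 1) (fun y => Real.log ‖y‖) x
      = 2 ^ m * Complex.normSq (((-1) ^ m * (Nat.factorial m : ℂ)) * ((zc x)⁻¹) ^ (m + 1)) := by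
    rw [← sum_re, gradSq]
    refine Finset.sum_congr rfl fun i _ => ?_
    rw [List.ofFn_succ, pdIter_log _ _ x hx, List.length_ofFn, mul_assoc]
  have hn : ‖x‖ ≠ 0 := by positivity
  rw [h]
  simp only [map_mul, map_pow, map_inv₀, zc_normSq, Complex.normSq_neg, map_one, one_pow, one_mul,
    Complex.normSq_natCast, Nat.add_sub_cancel]
  rw [inv_pow, ← pow_mul]
  field_simp
end
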